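/- arXiv:2405.14834 — 7 statements merged into one kernel-verified Lean document; each statement's English description precedes it below -/
import Mathlib

section
/- Let m ≥ 2 be an integer and let q_1, …, q_k be distinct m-th power-free positive integers. Then the real numbers q_1^{1/m}, …, q_k^{1/m} are linearly independent over ℚ. -/
/-- If `a` and `b` are `m`-th power-free and `a / b` is the `m`-th power of a nonnegative
rational `r`, then `a = b`. -/
theorem eq_of_powerFree_of_eq_mul_pow {m a b : ℕ}
    (hafree : ∀ p : ℕ, p.Prime → ¬ p ^ m ∣ a) (hbfree : ∀ p : ℕ, p.Prime → ¬ p ^ m ∣ b)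
    {r : ℚ} (hr : 0 ≤ r) (h : (a : ℚ) = b * r ^ m) : a = b := by
  obtain ⟨n, hn⟩ := Int.eq_ofNat_of_zero_le (Rat.num_nonneg.mpr hr)
  have hcop : n.Coprime r.den := by simpa [hn] using r.reduced
  have key : a * r.den ^ m = b * n ^ m := by
    have hrn : r * r.den = n := by rw [Rat.mul_den_eq_num, hn]; rfl
    have : (a : ℚ) * r.den ^ m = b * n ^ m := by rw [h, ← hrn, mul_pow, mul_assoc]
    exact_mod_cast this
  have hn1 : n = 1 := by
    by_contra hne
    obtain ⟨p, hp, hpn⟩ := Nat.exists_prime_and_dvd hne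
    refine hafree p hp ((pow_dvd_pow_of_dvd hpn m).trans ?_)
    exact (Nat.Coprime.pow m m hcop).dvd_of_dvd_mul_right (key ▸ dvd_mul_left _ _)
  have hd1 : r.den = 1 := by
    by_contra hne
    obtain ⟨p, hp, hpn⟩ := Nat.exists_prime_and_dvd hne
    refine hbfree p hp ((pow_dvd_pow_of_dvd hpn m).trans ?_)
    exact (Nat.Coprime.pow m m hcop.symm).dvd_of_dvd_mul_right (key ▸ dvd_mul_left _ _)
  simpa [hn1, hd1] using key

open Polynomial in
/-- The minimal polynomial of an irrational positive `m`-th root of a rational has vanishing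
subleading coefficient. -/
theorem minpoly_nextCoeff_eq_zero_of_pow_eq {m : ℕ} (hm : m ≠ 0) {x : ℝ} (hx : 0 < x)
    (hirr : x ∉ Set.range (algebraMap ℚ ℝ)) {a : ℚ} (ha : x ^ m = a) :
    (minpoly ℚ x).nextCoeff = 0 := by
  have hroot : aeval x (X ^ m - C a : ℚ[X]) = 0 := by simp [ha]
  have hint : IsIntegral ℚ x := ⟨_, monic_X_pow_sub_C a hm, by simpa [aeval_def] using hroot⟩
  set p := minpoly ℚ x with hp
  have hmonic : p.Monic := minpoly.monic hint
  have hdeg : 2 ≤ p.natDegree := (minpoly.two_le_natDegree_iff hint).mpr hirr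
  have hnorm : ∀ z ∈ (p.map (algebraMap ℚ ℂ)).roots, ‖z‖ = x := by
    intro z hz
    have hz0 : aeval z p = 0 := by
      simpa [aeval_def, eval_map] using (mem_roots'.mp hz).2
    have hz1 : aeval z (X ^ m - C a : ℚ[X]) = 0 :=
      aeval_eq_zero_of_dvd_aeval_eq_zero (minpoly.dvd ℚ x hroot) hz0
    have hz2 : z ^ m = ((x : ℂ)) ^ m := by
      have : (x : ℂ) ^ m = (a : ℂ) := by exact_mod_cast ha
      rw [this]
      simpa [sub_eq_zero] using hz1
    have hz3 := congrArg norm hz2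
    rw [norm_pow, norm_pow, Complex.norm_real, Real.norm_of_nonneg hx.le] at hz3
    exact (pow_left_inj₀ (norm_nonneg z) hx.le hm).mp hz3
  have hcoeff : |(p.coeff 0 : ℝ)| = x ^ p.natDegree := by
    have hs := IsAlgClosed.splits (p.map (algebraMap ℚ ℂ))
    have h0 := congrArg norm (hs.coeff_zero_eq_prod_roots_of_monic (hmonic.map _))
    have hc := hs.natDegree_eq_card_roots
    rw [natDegree_map] at hc
    have hprod : ‖(p.map (algebraMap ℚ ℂ)).roots.prod‖ = x ^ p.natDegree := by
      change (normHom : ℂ →*₀ ℝ) _ = _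
      rw [map_multiset_prod, hc, Multiset.map_congr (f := normHom) rfl hnorm, Multiset.map_const',
        Multiset.prod_replicate]
    rw [norm_mul, norm_pow, norm_neg, norm_one, one_pow, one_mul, hprod, coeff_map] at h0
    rw [← h0, eq_ratCast, ← Complex.ofReal_ratCast, Complex.norm_real, Real.norm_eq_abs]
  obtain ⟨b, hb⟩ : ∃ b : ℚ, x ^ p.natDegree = b := ⟨|p.coeff 0|, by rw [← hcoeff]; simp⟩
  have hpe : p = X ^ p.natDegree - C b := by
    refine (eq_of_monic_of_dvd_of_natDegree_le hmonic
      (monic_X_pow_sub_C b (by omega)) (minpoly.dvd ℚ x (by simp [hb])) ?_).symm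
    rw [natDegree_X_pow_sub_C]
  rw [nextCoeff_of_natDegree_pos (by omega), hpe, natDegree_X_pow_sub_C]
  rw [coeff_sub, coeff_X_pow, coeff_C, if_neg (by omega), if_neg (by omega), sub_zero]

/-- A finite family of positive reals whose pairwise ratios are irrational roots of rationals is
linearly independent over `ℚ`. -/
theorem eq_zero_of_sum_mul_eq_zero_of_div_pow_eq {ι : Type*} [Fintype ι] {m : ℕ} (hm : m ≠ 0)
    {α : ι → ℝ} (hα : ∀ j, 0 < α j) (hpow : ∀ j, ∃ a : ℚ, α j ^ m = a)
    (hirr : ∀ i j, i ≠ j → α i / α j ∉ Set.range (algebraMap ℚ ℝ))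
    {c : ι → ℚ} (hsum : ∑ j, (c j : ℝ) * α j = 0) (i : ι) : c i = 0 := by
  classical
  let K := IntermediateField.adjoin ℚ (Set.range α)
  have hfin : FiniteDimensional ℚ K := by
    refine IntermediateField.finiteDimensional_adjoin ?_
    rintro _ ⟨j, rfl⟩
    obtain ⟨a, ha⟩ := hpow j
    exact ⟨_, Polynomial.monic_X_pow_sub_C a hm, by simp [ha]⟩
  let β : ι → K := fun j => ⟨α j, IntermediateField.subset_adjoin _ _ ⟨j, rfl⟩⟩
  have htr : ∀ j, j ≠ i → Algebra.trace ℚ K (β j / β i) = 0 := by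
    intro j hj
    obtain ⟨a, ha⟩ := hpow j
    obtain ⟨b, hb⟩ := hpow i
    have h := minpoly_nextCoeff_eq_zero_of_pow_eq hm (div_pos (hα j) (hα i)) (hirr j i hj)
      (a := a / b) (by rw [div_pow, ha, hb]; push_cast; rfl)
    have hmin : minpoly ℚ (α j / α i) = minpoly ℚ (β j / β i) :=
      minpoly.algebraMap_eq (algebraMap K ℝ).injective (β j / β i)
    rw [trace_eq_finrank_mul_minpoly_nextCoeff, ← hmin, h]
    simp
  have hβi : β i ≠ 0 := fun h => (hα i).ne' (congrArg Subtype.val h)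
  have hsumK : ∑ j, c j • (β j / β i) = 0 := by
    have h : ∑ j, c j • β j = 0 := by
      apply Subtype.ext
      simpa [β, Rat.smul_def] using hsum
    simp only [← smul_div_assoc, ← Finset.sum_div, h, zero_div]
  have h := congrArg (Algebra.trace ℚ K) hsumK
  rw [map_sum, Finset.sum_eq_single i (fun j _ hj => by rw [map_smul, htr j hj, smul_zero])
    (by simp), div_self hβi, map_smul, map_zero, ← map_one (algebraMap ℚ K),
    Algebra.trace_algebraMap] at h
  simpa [Module.finrank_pos.ne'] using h

/-- Distinct `m`-th power-free positive integers have `m`-th roots that are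
linearly independent over `ℚ`. -/
theorem mth_roots_linear_independent
    (m k : ℕ) (hm : 2 ≤ m) (q : Fin k → ℕ)
    (hpos : ∀ j, 0 < q j)
    (hfree : ∀ j, ∀ p : ℕ, p.Prime → ¬ p ^ m ∣ q j)
    (hdist : Function.Injective q)
    (c : Fin k → ℚ)
    (hsum : ∑ j, (c j : ℝ) * (q j : ℝ) ^ ((1 : ℝ) / m) = 0) :
    ∀ j, c j = 0 := by
  have hm0 : m ≠ 0 := by omega
  have hα : ∀ j, 0 < (q j : ℝ) ^ ((1 : ℝ) / m) := fun j =>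
    Real.rpow_pos_of_pos (by exact_mod_cast hpos j) _
  have hpow : ∀ j, ((q j : ℝ) ^ ((1 : ℝ) / m)) ^ m = q j := fun j => by
    rw [one_div, Real.rpow_inv_natCast_pow (Nat.cast_nonneg _) hm0]
  refine eq_zero_of_sum_mul_eq_zero_of_div_pow_eq hm0 hα
    (fun j => ⟨q j, by rw [hpow, Rat.cast_natCast]⟩) ?_ hsum
  rintro i j hij ⟨r, hr⟩
  rw [eq_ratCast] at hr
  refine hij (hdist (eq_of_powerFree_of_eq_mul_pow (hfree i) (hfree j) (r := r) ?_ ?_))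
  · have : (0 : ℝ) ≤ r := hr ▸ (div_pos (hα i) (hα j)).le
    exact_mod_cast this
  · have h : (q i : ℝ) = q j * (r : ℝ) ^ m := by
      rw [hr, div_pow, hpow, hpow, mul_div_cancel₀ _ (by exact_mod_cast (hpos j).ne')]
    exact_mod_cast h
end

section
/- Let m ≥ 2 and k ≥ 1 be integers, let N ≥ 1 be an integer, and for j = 1, …, k let n_j be integers with 1 ≤ n_j ≤ N and ε_j ∈ {+1, −1}. If Σ_{j=1}^k ε_j n_j^{1/m} ≠ 0, then |Σ_{j=1}^k ε_j n_j^{1/m}| ≥ (k N^{1/m})^{−(m^k − 1)}. -/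
/-- The degree of a compositum of finitely many extensions, each of degree at most `m`. -/
theorem IntermediateField.finrank_finset_sup_le_pow {F E ι : Type*} [Field F] [Field E]
    [Algebra F E] (t : ι → IntermediateField F E) (m : ℕ)
    (ht : ∀ i, Module.finrank F (t i) ≤ m) (s : Finset ι) :
    Module.finrank F (s.sup t : IntermediateField F E) ≤ m ^ s.card := by
  classical
  induction s using Finset.induction_on with
  | empty => rw [Finset.sup_empty, IntermediateField.finrank_bot]; simp
  | insert a s ha ih =>
    rw [Finset.sup_insert, Finset.card_insert_of_notMem ha, pow_succ']
    exact (IntermediateField.finrank_sup_le _ _).trans (Nat.mul_le_mul (ht a) ih)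

/-- A Liouville-type inequality: the norm of a nonzero algebraic integer is at least one in
absolute value, so one conjugate is bounded below once all conjugates are bounded above. -/
theorem one_le_norm_mul_pow_of_isIntegral {K : Type*} [Field K] [Algebra ℚ K]
    [FiniteDimensional ℚ K] (φ : K →ₐ[ℚ] ℂ) (α : K) (h0 : α ≠ 0) (hα : IsIntegral ℤ α) (B : ℝ)
    (hB : ∀ σ : K →ₐ[ℚ] ℂ, ‖σ α‖ ≤ B) :
    1 ≤ ‖φ α‖ * B ^ (Module.finrank ℚ K - 1) := by
  classical
  obtain ⟨z, hz⟩ := IsIntegrallyClosed.isIntegral_iff.1 (Algebra.isIntegral_norm ℚ hα)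
  have hz0 : z ≠ 0 := by
    rintro rfl
    exact Algebra.norm_ne_zero_iff.2 h0 (hz.symm.trans (map_zero _))
  have hprod := Algebra.norm_eq_prod_embeddings ℚ ℂ α
  have h1 : 1 ≤ ‖∏ σ : K →ₐ[ℚ] ℂ, σ α‖ := by
    rw [← hprod, ← hz]
    have : (1 : ℝ) ≤ |(z : ℝ)| := by exact_mod_cast Int.one_le_abs hz0
    simpa using this
  rw [norm_prod, ← Finset.mul_prod_erase Finset.univ (fun σ : K →ₐ[ℚ] ℂ => ‖σ α‖) (Finset.mem_univ φ)] at h1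
  refine h1.trans (mul_le_mul_of_nonneg_left ?_ (norm_nonneg _))
  refine (Finset.prod_le_prod (fun _ _ => norm_nonneg _) fun σ _ => hB σ).trans_eq ?_
  rw [Finset.prod_const, Finset.card_erase_of_mem (Finset.mem_univ _), Finset.card_univ, AlgHom.card]

open IntermediateField in
/-- Liouville-type lower bound for an integer combination, with coefficients `±1`, of complex
`m`-th roots of natural numbers. -/
theorem one_le_norm_sum_mul_pow {ι : Type*} [Fintype ι] (m : ℕ) (hm : m ≠ 0) (n : ι → ℕ)
    (e : ι → ℤ) (he : ∀ i, |e i| = 1) (x : ι → ℂ) (hx : ∀ i, x i ^ m = n i) (b : ℝ)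
    (hb : ∀ i, (n i : ℝ) ≤ b ^ m) (hb1 : 1 ≤ b) (hcard : 1 ≤ Fintype.card ι)
    (hne : ∑ i, (e i : ℂ) * x i ≠ 0) :
    1 ≤ ‖∑ i, (e i : ℂ) * x i‖ * (Fintype.card ι * b) ^ (m ^ Fintype.card ι - 1) := by
  have hint (i : ι) : IsIntegral ℤ (x i) :=
    IsIntegral.of_pow (Nat.pos_of_ne_zero hm)
      (by simpa [hx] using isIntegral_algebraMap (R := ℤ) (A := ℂ) (x := (n i : ℤ)))
  have hintQ (i : ι) : IsIntegral ℚ (x i) := (hint i).tower_top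
  have hfin (i : ι) : FiniteDimensional ℚ (ℚ⟮x i⟯) :=
    IntermediateField.adjoin.finiteDimensional (hintQ i)
  have hdeg (i : ι) : Module.finrank ℚ (ℚ⟮x i⟯) ≤ m := by
    rw [IntermediateField.adjoin.finrank (hintQ i)]
    have h := Polynomial.natDegree_le_of_dvd (minpoly.dvd ℚ (x i)
      (p := Polynomial.X ^ m - Polynomial.C (n i : ℚ)) (by simp [hx]))
      (Polynomial.X_pow_sub_C_ne_zero (Nat.pos_of_ne_zero hm) _)
    rwa [Polynomial.natDegree_X_pow_sub_C] at h
  let K : IntermediateField ℚ ℂ := ⨆ i, ℚ⟮x i⟯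
  have hK : Module.finrank ℚ K ≤ m ^ Fintype.card ι := by
    have h := IntermediateField.finrank_finset_sup_le_pow (fun i => ℚ⟮x i⟯) m hdeg Finset.univ
    rwa [Finset.sup_univ_eq_iSup] at h
  have hxK (i : ι) : x i ∈ K :=
    le_iSup (fun i => ℚ⟮x i⟯) i (IntermediateField.mem_adjoin_simple_self ℚ (x i))
  let y (i : ι) : K := ⟨x i, hxK i⟩
  have hy (i : ι) : y i ^ m = n i := Subtype.ext (by simp [y, hx])
  let α : K := ∑ i, (e i : K) * y i
  have hα : (α : ℂ) = ∑ i, (e i : ℂ) * x i := by simp [α, y]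
  have hyint (i : ι) : IsIntegral ℤ (y i) :=
    (isIntegral_algHom_iff (K.val.restrictScalars ℤ) K.val.injective).1 (hint i)
  have hαint : IsIntegral ℤ α := IsIntegral.sum _ fun i _ =>
    (by simpa using isIntegral_algebraMap (R := ℤ) (A := K) (x := e i) : IsIntegral ℤ (e i : K)).mul (hyint i)
  have hconj (σ : K →ₐ[ℚ] ℂ) : ‖σ α‖ ≤ Fintype.card ι * b := by
    have hterm (i : ι) : ‖σ ((e i : K) * y i)‖ ≤ b := by
      have he' : ‖(e i : ℂ)‖ = 1 := by
        rw [Complex.norm_intCast]; exact_mod_cast he i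
      rw [map_mul, map_intCast, norm_mul, he', one_mul]
      refine le_of_pow_le_pow_left₀ hm (by linarith) ?_
      rw [← norm_pow, ← map_pow, hy, map_natCast, Complex.norm_natCast]
      exact hb i
    rw [map_sum]
    refine (norm_sum_le _ _).trans ((Finset.sum_le_sum fun i _ => hterm i).trans_eq ?_)
    simp
  have h := one_le_norm_mul_pow_of_isIntegral K.val α (fun h => hne (by rw [← hα, h]; simp)) hαint _
    hconj
  rw [IntermediateField.coe_val, hα] at h
  have hB : (1 : ℝ) ≤ Fintype.card ι * b :=
    one_le_mul_of_one_le_of_one_le (by exact_mod_cast hcard) hb1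
  exact h.trans (mul_le_mul_of_nonneg_left
    (pow_le_pow_right₀ hB (Nat.sub_le_sub_right hK 1)) (norm_nonneg _))

/-- A quantitative lower bound for non-vanishing signed sums of `m`-th roots of
positive integers up to `N`. -/
theorem signed_sum_mth_roots_lower_bound
    (m k N : ℕ) (hm : 2 ≤ m) (hk : 1 ≤ k) (hN : 1 ≤ N)
    (n : Fin k → ℕ) (hn : ∀ j, 1 ≤ n j ∧ n j ≤ N)
    (ε : Fin k → ℝ) (hε : ∀ j, ε j = 1 ∨ ε j = -1)
    (hne : ∑ j, ε j * (n j : ℝ) ^ ((1 : ℝ) / m) ≠ 0) :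
    |∑ j, ε j * (n j : ℝ) ^ ((1 : ℝ) / m)|
      ≥ ((k : ℝ) * (N : ℝ) ^ ((1 : ℝ) / m)) ^ (-(((m : ℝ) ^ k) - 1)) := by
  have hm0 : m ≠ 0 := by omega
  have hroot (a : ℕ) : ((a : ℝ) ^ ((1 : ℝ) / m)) ^ m = a := by
    rw [one_div]
    exact Real.rpow_inv_natCast_pow a.cast_nonneg hm0
  have hsign (j : Fin k) : ∃ z : ℤ, |z| = 1 ∧ (z : ℝ) = ε j := by
    rcases hε j with h | h
    · exact ⟨1, by simp, by simp [h]⟩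
    · exact ⟨-1, by simp, by simp [h]⟩
  choose e he heε using hsign
  have hb1 : (1 : ℝ) ≤ (N : ℝ) ^ ((1 : ℝ) / m) :=
    Real.one_le_rpow (by exact_mod_cast hN) (by positivity)
  have hcast : ∑ j, (e j : ℂ) * (((n j : ℝ) ^ ((1 : ℝ) / m) : ℝ) : ℂ)
      = ((∑ j, ε j * (n j : ℝ) ^ ((1 : ℝ) / m) : ℝ) : ℂ) := by
    simp only [← heε]
    push_cast
    rfl
  have h := one_le_norm_sum_mul_pow m hm0 n e he
    (fun j => (((n j : ℝ) ^ ((1 : ℝ) / m) : ℝ) : ℂ))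
    (fun j => by rw [← Complex.ofReal_pow, hroot]; simp) ((N : ℝ) ^ ((1 : ℝ) / m))
    (fun j => by rw [hroot]; exact_mod_cast (hn j).2) hb1 (by simpa using hk)
    (by rw [hcast]; exact_mod_cast hne)
  rw [hcast, Complex.norm_real, Real.norm_eq_abs, Fintype.card_fin] at h
  have hB : (0 : ℝ) < (k : ℝ) * (N : ℝ) ^ ((1 : ℝ) / m) := by
    have : (0 : ℝ) < k := by exact_mod_cast hk
    positivity
  have hexp : (m : ℝ) ^ k - 1 = ((m ^ k - 1 : ℕ) : ℝ) := by
    rw [Nat.cast_sub (Nat.one_le_pow _ _ (by omega))]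
    simp
  rw [ge_iff_le, hexp, Real.rpow_neg hB.le, Real.rpow_natCast,
    inv_le_iff_one_le_mul₀ (by positivity)]
  exact h
end

section
/- Let m ≥ 2 be an integer and let r be a positive real number with r ∉ ℚ and r^m ∈ ℚ. Let m' be the smallest integer with 1 < m' ≤ m and r^{m'} ∈ ℚ. Then the minimal polynomial of r over ℚ is X^{m'} − r^{m'}; in particular [ℚ(r) : ℚ] = m'. -/
open Polynomial IntermediateField

/-- If every complex root of a monic rational polynomial has norm `r`, then `r ^ natDegree` is
the absolute value of its constant coefficient. -/
theorem Polynomial.Monic.abs_coeff_zero_eq_pow_of_norm_root {p : ℚ[X]} (hp : p.Monic) {r : ℝ}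
    (h : ∀ z : ℂ, aeval z p = 0 → ‖z‖ = r) : ((|p.coeff 0| : ℚ) : ℝ) = r ^ p.natDegree := by
  have hmonic : (p.map (algebraMap ℚ ℂ)).Monic := hp.map _
  have hsplits := IsAlgClosed.splits (p.map (algebraMap ℚ ℂ))
  have hcoeff := congrArg norm (hsplits.coeff_zero_eq_prod_roots_of_monic hmonic)
  have hroots : ∀ x ∈ (p.map (algebraMap ℚ ℂ)).roots.map norm, x = r := by
    intro x hx
    obtain ⟨z, hz, rfl⟩ := Multiset.mem_map.mp hx
    refine h z ?_
    rw [← eval_map_algebraMap]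
    exact (mem_roots'.mp hz).2
  have hprod : ‖(p.map (algebraMap ℚ ℂ)).roots.prod‖ = r ^ p.natDegree := by
    have hmap : ‖(p.map (algebraMap ℚ ℂ)).roots.prod‖ =
        ((p.map (algebraMap ℚ ℂ)).roots.map norm).prod :=
      map_multiset_prod (normHom : ℂ →*₀ ℝ) _
    rw [hmap, Multiset.eq_replicate_card.mpr hroots, Multiset.prod_replicate, Multiset.card_map,
      ← hsplits.natDegree_eq_card_roots, hp.natDegree_map]
  rw [norm_mul, norm_pow, norm_neg, norm_one, one_pow, one_mul, hprod] at hcoeff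
  rw [← hcoeff]
  simp [coeff_map]

/-- If `r > 0` is irrational with `r ^ m` rational, and `m'` is the smallest
integer with `1 < m' ≤ m` and `r ^ m'` rational, then the minimal polynomial of
`r` over `ℚ` is `X ^ m' - r ^ m'`; in particular `[ℚ(r) : ℚ] = m'`. -/
theorem minpoly_of_root_of_rational_power
    (m m' : ℕ) (hm : 2 ≤ m) (r : ℝ) (hr : 0 < r)
    (hirr : ¬ ∃ a : ℚ, (a : ℝ) = r)
    (hm'1 : 1 < m') (hm'm : m' ≤ m)
    (a : ℚ) (ha : (a : ℝ) = r ^ m')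
    (hmin : ∀ l : ℕ, 1 < l → l < m' → ¬ ∃ b : ℚ, (b : ℝ) = r ^ l) :
    minpoly ℚ r = X ^ m' - C a ∧ Module.finrank ℚ ℚ⟮r⟯ = m' := by
  have hm0 : m' ≠ 0 := by omega
  have hmonic : (X ^ m' - C a : ℚ[X]).Monic := monic_X_pow_sub_C a hm0
  have hroot : aeval r (X ^ m' - C a : ℚ[X]) = 0 := by simp [ha]
  have hint : IsIntegral ℚ r := ⟨_, hmonic, hroot⟩
  have hdvd : minpoly ℚ r ∣ X ^ m' - C a := minpoly.dvd ℚ r hroot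
  have hnorm : ∀ z : ℂ, aeval z (minpoly ℚ r) = 0 → ‖z‖ = r := by
    intro z hz
    have hz' : z ^ m' = ((r ^ m' : ℝ) : ℂ) := by
      have := aeval_eq_zero_of_dvd_aeval_eq_zero hdvd hz
      rw [← ha]
      simpa [sub_eq_zero] using this
    refine (pow_left_inj₀ (norm_nonneg z) hr.le hm0).mp ?_
    rw [← norm_pow, hz', Complex.norm_real, Real.norm_of_nonneg (pow_nonneg hr.le _)]
  have hrat := (minpoly.monic hint).abs_coeff_zero_eq_pow_of_norm_root hnorm
  have hdeg : m' ≤ (minpoly ℚ r).natDegree := by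
    by_contra! hlt
    rcases Nat.lt_or_ge 1 (minpoly ℚ r).natDegree with hd | hd
    · exact hmin _ hd hlt ⟨_, hrat⟩
    · exact hirr ⟨_, by rw [hrat, le_antisymm hd (minpoly.natDegree_pos hint), pow_one]⟩
  have heq : minpoly ℚ r = X ^ m' - C a :=
    (eq_of_monic_of_dvd_of_natDegree_le (minpoly.monic hint) hmonic hdvd
      (by rwa [natDegree_X_pow_sub_C])).symm
  exact ⟨heq, by rw [adjoin.finrank hint, heq, natDegree_X_pow_sub_C]⟩
end

section
/- Let m ≥ 2 be an integer and let r be a positive real number with r ∉ ℚ and r^m ∈ ℚ. Then for every number field K (a finite field extension of ℚ) containing r, the field trace Tr_{K/ℚ}(r) equals 0. -/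
open Polynomial IntermediateField in
/-- The minimal polynomial over `ℚ` of a positive real number with a rational power is
`X ^ n - c` for some rational `c`. -/
theorem exists_minpoly_eq_X_pow_sub_C {m : ℕ} (hm : m ≠ 0) {r : ℝ} (hr : 0 < r)
    (hrat : ∃ a : ℚ, (a : ℝ) = r ^ m) (hint : IsIntegral ℚ r) :
    ∃ c : ℚ, minpoly ℚ r = X ^ (minpoly ℚ r).natDegree - C c := by
  obtain ⟨a, ha⟩ := hrat
  set n := (minpoly ℚ r).natDegree with hn
  have hn0 : n ≠ 0 := (minpoly.natDegree_pos hint).ne'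
  set c : ℚ := Algebra.norm ℚ (AdjoinSimple.gen ℚ r) with hc
  have hgen : AdjoinSimple.gen ℚ r ^ m = algebraMap ℚ ℚ⟮r⟯ a := by
    apply Subtype.ext
    simpa using ha.symm
  have hcm : c ^ m = a ^ n := by
    rw [hc, ← map_pow, hgen, Algebra.norm_algebraMap, adjoin.finrank hint]
  have hcr : ((|c| : ℚ) : ℝ) = r ^ n := by
    refine (pow_left_inj₀ (by positivity) (by positivity) hm).1 ?_
    have hcm' : (c : ℝ) ^ m = a ^ n := mod_cast hcm
    rw [Rat.cast_abs, ← abs_pow, hcm', ha, abs_of_pos (by positivity), pow_right_comm]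
  have hroot : aeval r (X ^ n - C |c|) = 0 := by
    simp [← hcr]
  exact ⟨|c|, (minpoly.unique_of_degree_le_degree_minpoly ℚ r (monic_X_pow_sub_C _ hn0) hroot
    (by rw [degree_X_pow_sub_C (Nat.pos_of_ne_zero hn0),
      degree_eq_natDegree (minpoly.ne_zero hint)])).symm⟩

/-- If `r > 0` is irrational with `r ^ m` rational for some `m ≥ 2`, then the
trace of `r` from any number field containing `r` down to `ℚ` vanishes. -/
theorem trace_eq_zero_of_rational_power
    (m : ℕ) (hm : 2 ≤ m) (r : ℝ) (hr : 0 < r)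
    (hirr : ¬ ∃ a : ℚ, (a : ℝ) = r)
    (hrat : ∃ a : ℚ, (a : ℝ) = r ^ m)
    (K : IntermediateField ℚ ℝ) (hK : FiniteDimensional ℚ K)
    (hrK : r ∈ K) :
    Algebra.trace ℚ K ⟨r, hrK⟩ = 0 := by
  have hmin : minpoly ℚ (⟨r, hrK⟩ : K) = minpoly ℚ r :=
    (minpoly.algebraMap_eq (algebraMap K ℝ).injective (⟨r, hrK⟩ : K)).symm
  have hint : IsIntegral ℚ r :=
    (IsIntegral.of_finite ℚ (⟨r, hrK⟩ : K)).map (IsScalarTower.toAlgHom ℚ K ℝ)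
  obtain ⟨c, hc⟩ := exists_minpoly_eq_X_pow_sub_C (by omega) hr hrat hint
  have hdeg : 2 ≤ (minpoly ℚ r).natDegree :=
    (minpoly.two_le_natDegree_iff hint).2 hirr
  have hnext : (minpoly ℚ r).nextCoeff = 0 := by
    rw [Polynomial.nextCoeff_of_natDegree_pos (by omega), hc, Polynomial.natDegree_X_pow_sub_C,
      Polynomial.coeff_sub, Polynomial.coeff_X_pow, Polynomial.coeff_C]
    rw [if_neg (by omega), if_neg (by omega), sub_zero]
  rw [trace_eq_finrank_mul_minpoly_nextCoeff, hmin, hnext, neg_zero, mul_zero]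
end

section
/- Let m ≥ 2 and r ≥ 1 be integers, D > 0 and c > 0 real numbers, and λ : ℕ → ℝ a sequence such that (Σ_{n≤y} λ(n)²)/(y (log 2y)^{r−1}) → c as y → ∞. Set n̆ := m(n/D)^{1/m}. Then, as δ → 0⁺, the ratio [(2/π²) Σ_{n=1}^∞ (λ(n)²/n) · sin²(π n̆ δ)/n̆] / [m^r δ (log(1/δ))^{r−1}] converges to c. -/
open Real Filter Topology

/-- The summatory function `∑_{k ≤ y} a k` of a real sequence. -/
noncomputable def partialSum (a : ℕ → ℝ) (y : ℝ) : ℝ := ∑ k ∈ Finset.Icc 0 ⌊y⌋₊, a k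

section PartialSum

variable {a : ℕ → ℝ}

theorem partialSum_nonneg (ha : ∀ n, 0 ≤ a n) (y : ℝ) : 0 ≤ partialSum a y :=
  Finset.sum_nonneg fun n _ => ha n

theorem partialSum_mono (ha : ∀ n, 0 ≤ a n) : Monotone (partialSum a) := fun _ _ h =>
  Finset.sum_le_sum_of_subset_of_nonneg (Finset.Icc_subset_Icc_right (Nat.floor_le_floor h))
    fun n _ _ => ha n

theorem partialSum_of_lt_one (ha0 : a 0 = 0) {y : ℝ} (hy : y < 1) : partialSum a y = 0 := by
  simp [partialSum, Nat.floor_eq_zero.2 hy, ha0]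

/-- Abel summation for `∑ φ(k / X) a k`, in the variable `t = k / X`. -/
theorem sum_scaled_mul_eq {φ φ' : ℝ → ℝ} {X s T : ℝ} (hX : 0 < X) (hs : 0 < s) (hsT : s ≤ T)
    (hφ : ∀ t, 0 < t → HasDerivAt φ (φ' t) t) (hc : ContinuousOn φ' (Set.Ioi 0)) :
    ∑ k ∈ Finset.Ioc ⌊X * s⌋₊ ⌊X * T⌋₊, φ (k / X) * a k =
      φ T * partialSum a (X * T) - φ s * partialSum a (X * s) -
        ∫ t in Set.Ioc s T, φ' t * partialSum a (X * t) := by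
  have hd : ∀ y, 0 < y → HasDerivAt (fun y => φ (y / X)) (φ' (y / X) / X) y := by
    intro y hy
    have := (hφ (y / X) (by positivity)).comp y ((hasDerivAt_id y).div_const X)
    simpa [div_eq_mul_inv] using! this
  have hpos : ∀ y ∈ Set.Icc (X * s) (X * T), 0 < y := fun y hy =>
    lt_of_lt_of_le (by positivity) hy.1
  have hint : MeasureTheory.IntegrableOn (deriv fun y => φ (y / X))
      (Set.Icc (X * s) (X * T)) := by
    refine ContinuousOn.integrableOn_Icc ?_
    refine ContinuousOn.congr (f := fun y => φ' (y / X) / X) ?_ fun y hy => (hd y (hpos y hy)).deriv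
    refine (hc.comp (by fun_prop) fun y hy => ?_).div_const X
    exact div_pos (hpos y hy) hX
  rw [sum_mul_eq_sub_sub_integral_mul a (f := fun y => φ (y / X)) (by positivity)
    (by gcongr) (fun t ht => (hd t (hpos t ht)).differentiableAt) hint]
  have e1 : X * T / X = T := by field_simp
  have e2 : X * s / X = s := by field_simp
  rw [e1, e2]
  congr 1
  rw [← intervalIntegral.integral_of_le (by gcongr), ← intervalIntegral.integral_of_le hsT]
  have := intervalIntegral.smul_integral_comp_mul_left (a := s) (b := T)
    (fun y => deriv (fun y => φ (y / X)) y * ∑ k ∈ Finset.Icc 0 ⌊y⌋₊, a k) X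
  rw [← this, smul_eq_mul, ← intervalIntegral.integral_const_mul]
  refine intervalIntegral.integral_congr fun t ht => ?_
  rw [Set.uIcc_of_le hsT] at ht
  have ht0 : 0 < t := hs.trans_le ht.1
  have e3 : X * t / X = t := by field_simp
  simp only [(hd (X * t) (by positivity)).deriv, e3, partialSum]
  field_simp

variable {k : ℕ} {c : ℝ}

theorem log_two_mul_pos {y : ℝ} (hy : 1 ≤ y) : 0 < log (2 * y) := log_pos (by linarith)

theorem exists_partialSum_le (ha : ∀ n, 0 ≤ a n)
    (hA : Tendsto (fun y => partialSum a y / (y * log (2 * y) ^ k)) atTop (𝓝 c)) :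
    ∃ C, 0 < C ∧ ∀ y, 1 ≤ y → partialSum a y ≤ C * (y * log (2 * y) ^ k) := by
  obtain ⟨y₀, hy₀⟩ := eventually_atTop.1 (hA.eventually (gt_mem_nhds (lt_add_one c)))
  have hl2 : 0 < log 2 := log_pos one_lt_two
  refine ⟨max 1 (max (c + 1) (partialSum a y₀ / log 2 ^ k)), by positivity, fun y hy => ?_⟩
  have hl := log_two_mul_pos hy
  have hw : 0 < y * log (2 * y) ^ k := by positivity
  rcases le_total y₀ y with h | h
  · have := (div_lt_iff₀ hw).1 (hy₀ y h)
    refine this.le.trans ?_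
    gcongr
    exact (le_max_left _ _).trans (le_max_right _ _)
  · refine (partialSum_mono ha h).trans ?_
    have h1 : log 2 ^ k ≤ y * log (2 * y) ^ k := by
      have : log 2 ≤ log (2 * y) := log_le_log (by norm_num) (by linarith)
      calc log 2 ^ k = 1 * log 2 ^ k := (one_mul _).symm
        _ ≤ _ := by gcongr
    calc partialSum a y₀ = partialSum a y₀ / log 2 ^ k * log 2 ^ k := by field_simp
      _ ≤ _ := by
        gcongr
        exact (le_max_right _ _).trans (le_max_right _ _)

/-- A Potter-type bound for the logarithm. -/
theorem exists_log_mul_pow_le (k : ℕ) {q : ℝ} (hq : 0 < q) :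
    ∃ K, 0 < K ∧ ∀ X t, 1 ≤ X → 0 < t → 1 ≤ X * t →
      log (2 * (X * t)) ^ k ≤ K * log (2 * X) ^ k * (1 + t) ^ q := by
  have hl2 : 0 < log 2 := log_pos one_lt_two
  set ε := q / (k + 1) with hε
  have hε0 : 0 < ε := by positivity
  refine ⟨(1 + 1 / (ε * log 2)) ^ k, by positivity, fun X t hX ht hXt => ?_⟩
  have hlX : log 2 ≤ log (2 * X) := log_le_log (by norm_num) (by linarith)
  have h1 : log (2 * (X * t)) ≤ log (2 * X) + log (1 + t) := by
    rw [← log_mul (by positivity) (by positivity)]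
    exact log_le_log (by positivity) (by nlinarith)
  have h2 : log (1 + t) ≤ (1 + t) ^ ε / ε := log_le_rpow_div (by positivity) hε0
  have h3 : 1 ≤ (1 + t) ^ ε := one_le_rpow (by linarith) hε0.le
  have h4 : log (2 * (X * t)) ≤ (1 + 1 / (ε * log 2)) * log (2 * X) * (1 + t) ^ ε := by
    have h5 : (1 + t) ^ ε / ε ≤ 1 / (ε * log 2) * log (2 * X) * (1 + t) ^ ε := by
      have : 1 / ε ≤ 1 / (ε * log 2) * log (2 * X) := by
        rw [div_mul_eq_mul_div, one_mul, div_le_div_iff₀ hε0 (by positivity)]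
        nlinarith
      calc (1 + t) ^ ε / ε = 1 / ε * (1 + t) ^ ε := by ring
        _ ≤ _ := by gcongr
    nlinarith
  have h6 : ((1 + t) ^ ε) ^ k ≤ (1 + t) ^ q := by
    rw [← rpow_natCast, ← rpow_mul (by positivity)]
    refine rpow_le_rpow_of_exponent_le (by linarith) ?_
    rw [hε, div_mul_eq_mul_div, div_le_iff₀ (by positivity)]
    nlinarith
  calc log (2 * (X * t)) ^ k ≤ ((1 + 1 / (ε * log 2)) * log (2 * X) * (1 + t) ^ ε) ^ k := by
        have := (log_two_mul_pos hXt).le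
        gcongr
    _ = (1 + 1 / (ε * log 2)) ^ k * log (2 * X) ^ k * ((1 + t) ^ ε) ^ k := by rw [mul_pow, mul_pow]
    _ ≤ _ := by
        have := (log_two_mul_pos hX).le
        gcongr

theorem exists_partialSum_mul_le (ha : ∀ n, 0 ≤ a n) (ha0 : a 0 = 0)
    (hA : Tendsto (fun y => partialSum a y / (y * log (2 * y) ^ k)) atTop (𝓝 c))
    {q : ℝ} (hq : 0 < q) :
    ∃ C, 0 < C ∧ ∀ X t, 1 ≤ X → 0 < t →
      partialSum a (X * t) ≤ C * (X * log (2 * X) ^ k) * (t * (1 + t) ^ q) := by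
  obtain ⟨C, hC, hCb⟩ := exists_partialSum_le ha hA
  obtain ⟨K, hK, hKb⟩ := exists_log_mul_pow_le k hq
  refine ⟨C * K, by positivity, fun X t hX ht => ?_⟩
  have := log_two_mul_pos hX
  rcases lt_or_ge (X * t) 1 with h | h
  · rw [partialSum_of_lt_one ha0 h]
    positivity
  · calc partialSum a (X * t) ≤ C * (X * t * log (2 * (X * t)) ^ k) := hCb _ h
      _ ≤ C * (X * t * (K * log (2 * X) ^ k * (1 + t) ^ q)) := by
        gcongr
        exact hKb X t hX ht h
      _ = _ := by ring

/-- Uniform bound for the tails of `∑ (n / X)^(-1-p) a n`. -/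
theorem exists_tail_le (ha : ∀ n, 0 ≤ a n) (ha0 : a 0 = 0)
    (hA : Tendsto (fun y => partialSum a y / (y * log (2 * y) ^ k)) atTop (𝓝 c))
    {p : ℝ} (hp : 0 < p) :
    ∃ C, 0 < C ∧ ∀ X T, 1 ≤ X → 1 ≤ T → ∀ N : ℕ,
      ∑ n ∈ Finset.Ioc ⌊X * T⌋₊ N, ((n : ℝ) / X) ^ (-1 - p) * a n ≤
        C * (X * log (2 * X) ^ k) * T ^ (-(p / 2)) := by
  set q := p / 2 with hq
  have hq0 : 0 < q := by positivity
  obtain ⟨C, hC, hCb⟩ := exists_partialSum_mul_le ha ha0 hA hq0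
  refine ⟨C * 2 ^ q * (1 + (1 + p) / q), by positivity, fun X T hX hT N => ?_⟩
  have hlX := log_two_mul_pos hX
  have hX0 : 0 < X := by linarith
  have hT0 : 0 < T := by linarith
  set M := C * (X * log (2 * X) ^ k) with hM
  have hM0 : 0 < M := by positivity
  rcases lt_or_ge (N : ℝ) (X * T) with h | h
  · rw [Finset.Ioc_eq_empty_of_le (Nat.le_floor h.le), Finset.sum_empty]
    positivity
  have hb : ∀ t, 1 ≤ t → partialSum a (X * t) ≤ M * 2 ^ q * t ^ (1 + q) := by
    intro t ht
    have ht0 : 0 < t := by linarith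
    calc partialSum a (X * t) ≤ M * (t * (1 + t) ^ q) := hCb X t hX ht0
      _ ≤ M * (t * (2 * t) ^ q) := by gcongr; linarith
      _ = _ := by rw [mul_rpow (by norm_num) ht0.le, rpow_add ht0, rpow_one]; ring
  set S := (N : ℝ) / X with hS
  have hNS : X * S = N := by rw [hS]; field_simp
  have hTS : T ≤ S := by rw [hS, le_div_iff₀ hX0]; linarith
  have hS0 : 0 < S := by linarith
  have habel := sum_scaled_mul_eq (a := a) (φ := fun t => t ^ (-1 - p))
    (φ' := fun t => (-1 - p) * t ^ (-1 - p - 1)) hX0 hT0 hTS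
    (fun t ht => hasDerivAt_rpow_const (Or.inl ht.ne'))
    (continuousOn_const.mul (continuousOn_id.rpow_const fun t ht => Or.inl (ne_of_gt ht)))
  rw [hNS, Nat.floor_natCast] at habel
  rw [habel]
  have h1 : S ^ (-1 - p) * partialSum a N ≤ M * 2 ^ q * T ^ (-q) := by
    rw [← hNS]
    calc S ^ (-1 - p) * partialSum a (X * S) ≤ S ^ (-1 - p) * (M * 2 ^ q * S ^ (1 + q)) := by
          gcongr; exact hb S (by linarith)
      _ = M * 2 ^ q * S ^ (-q) := by
          have : S ^ (-q) = S ^ (-1 - p) * S ^ (1 + q) := by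
            rw [← rpow_add hS0]; congr 1; rw [hq]; ring
          rw [this]; ring
      _ ≤ _ := by
          gcongr ?_ * ?_
          exact rpow_le_rpow_of_nonpos hT0 hTS (by linarith)
  have h2 : 0 ≤ T ^ (-1 - p) * partialSum a (X * T) :=
    mul_nonneg (by positivity) (partialSum_nonneg ha _)
  have h3 : -∫ t in Set.Ioc T S, (-1 - p) * t ^ (-1 - p - 1) * partialSum a (X * t) ≤
      M * 2 ^ q * ((1 + p) / q) * T ^ (-q) := by
    rw [← MeasureTheory.integral_neg]
    have hi := (integrableOn_Ioi_rpow_of_lt (show -1 - q < -1 by linarith) hT0)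
    calc ∫ t in Set.Ioc T S, -((-1 - p) * t ^ (-1 - p - 1) * partialSum a (X * t))
        ≤ ∫ t in Set.Ioc T S, M * 2 ^ q * (1 + p) * t ^ (-1 - q) := by
          refine MeasureTheory.integral_mono_of_nonneg ?_ ?_ ?_
          · filter_upwards [MeasureTheory.ae_restrict_mem measurableSet_Ioc] with t ht
            have ht0 : 0 < t := hT0.trans ht.1
            have := partialSum_nonneg ha (X * t)
            have : 0 ≤ (1 + p) * t ^ (-1 - p - 1) * partialSum a (X * t) := by positivity
            simp only [Pi.zero_apply]
            linarith
          · exact (hi.mono_set Set.Ioc_subset_Ioi_self).const_mul _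
          · filter_upwards [MeasureTheory.ae_restrict_mem measurableSet_Ioc] with t ht
            have ht0 : 0 < t := hT0.trans ht.1
            calc -((-1 - p) * t ^ (-1 - p - 1) * partialSum a (X * t))
                = (1 + p) * t ^ (-1 - p - 1) * partialSum a (X * t) := by ring
              _ ≤ (1 + p) * t ^ (-1 - p - 1) * (M * 2 ^ q * t ^ (1 + q)) := by
                  gcongr; exact hb t (by linarith [ht.1])
              _ = _ := by
                  have : t ^ (-1 - q) = t ^ (-1 - p - 1) * t ^ (1 + q) := by
                    rw [← rpow_add ht0]; congr 1; rw [hq]; ring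
                  rw [this]; ring
      _ = M * 2 ^ q * (1 + p) * ∫ t in Set.Ioc T S, t ^ (-1 - q) :=
          MeasureTheory.integral_const_mul _ _
      _ ≤ M * 2 ^ q * (1 + p) * ∫ t in Set.Ioi T, t ^ (-1 - q) := by
          gcongr ?_ * ?_
          refine MeasureTheory.setIntegral_mono_set hi ?_ Set.Ioc_subset_Ioi_self.eventuallyLE
          filter_upwards [MeasureTheory.ae_restrict_mem measurableSet_Ioi] with t ht
          have ht0 : 0 < t := hT0.trans ht
          simp only [Pi.zero_apply]
          positivity
      _ = _ := by
          rw [integral_Ioi_rpow_of_lt (by linarith) hT0, show -1 - q + 1 = -q by ring]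
          field_simp
  calc _ ≤ M * 2 ^ q * T ^ (-q) + M * 2 ^ q * ((1 + p) / q) * T ^ (-q) := by linarith
    _ = _ := by rw [hM]; ring

end PartialSum

section Kernel

open MeasureTheory

variable {φ φ' : ℝ → ℝ} {B p : ℝ}

theorem integrableOn_Ioc_rpow_sub_one (hp : 0 < p) {T : ℝ} (hT : 0 ≤ T) :
    IntegrableOn (fun t : ℝ => t ^ (p - 1)) (Set.Ioc 0 T) :=
  (intervalIntegrable_iff_integrableOn_Ioc_of_le hT).1
    (intervalIntegral.intervalIntegrable_rpow' (by linarith))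

theorem integrableOn_Ioc_of_abs_le_rpow {ψ : ℝ → ℝ} (hp : 0 < p) {T : ℝ} (hT : 0 ≤ T)
    (hc : ContinuousOn ψ (Set.Ioi 0)) (hb : ∀ t, 0 < t → |ψ t| ≤ B * t ^ (p - 1)) :
    IntegrableOn ψ (Set.Ioc 0 T) := by
  refine Integrable.mono' ((integrableOn_Ioc_rpow_sub_one hp hT).const_mul B)
    ((hc.mono Set.Ioc_subset_Ioi_self).aestronglyMeasurable measurableSet_Ioc) ?_
  filter_upwards [ae_restrict_mem measurableSet_Ioc] with t ht
  exact hb t ht.1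

theorem abs_id_mul_le (hb' : ∀ t, 0 < t → |φ' t| ≤ B * t ^ (p - 2)) {t : ℝ} (ht : 0 < t) :
    |t * φ' t| ≤ B * t ^ (p - 1) := by
  rw [abs_mul, abs_of_pos ht, show p - 1 = 1 + (p - 2) by ring, rpow_add ht, rpow_one]
  nlinarith [hb' t ht]

theorem integral_Ioc_eq_sub (hp : 0 < p) {T : ℝ} (hT : 0 < T)
    (hφ : ∀ t, 0 < t → HasDerivAt φ (φ' t) t) (hc : ContinuousOn φ' (Set.Ioi 0))
    (hb : ∀ t, 0 < t → |φ t| ≤ B * t ^ (p - 1))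
    (hb' : ∀ t, 0 < t → |φ' t| ≤ B * t ^ (p - 2)) :
    ∫ t in Set.Ioc 0 T, φ t = T * φ T - ∫ t in Set.Ioc 0 T, t * φ' t := by
  have hcφ : ContinuousOn φ (Set.Ioi 0) := fun t ht =>
    (hφ t ht).continuousAt.continuousWithinAt
  have i1 := integrableOn_Ioc_of_abs_le_rpow hp hT.le hcφ hb
  have i2 : IntegrableOn (fun t => t * φ' t) (Set.Ioc 0 T) :=
    integrableOn_Ioc_of_abs_le_rpow hp hT.le (continuousOn_id.mul hc)
      fun t ht => abs_id_mul_le hb' ht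
  have hd : ∀ t, 0 < t → HasDerivAt (fun t => t * φ t) (φ t + t * φ' t) t := fun t ht => by
    simpa using! (hasDerivAt_id t).mul (hφ t ht)
  have h0 : Tendsto (fun t => t * φ t) (𝓝[>] 0) (𝓝 0) := by
    have : Tendsto (fun t : ℝ => B * t ^ p) (𝓝[>] 0) (𝓝 0) := by
      have := ((continuous_rpow_const hp.le).tendsto (0 : ℝ)).const_mul B
      rw [zero_rpow hp.ne', mul_zero] at this
      exact this.mono_left nhdsWithin_le_nhds
    refine squeeze_zero_norm' ?_ this
    filter_upwards [self_mem_nhdsWithin] with t ht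
    have ht : 0 < t := ht
    rw [norm_mul, norm_eq_abs, norm_eq_abs, abs_of_pos ht, show p = 1 + (p - 1) by ring,
      rpow_add ht, rpow_one]
    nlinarith [hb t ht]
  have key := intervalIntegral.integral_eq_sub_of_hasDerivAt_of_tendsto hT
    (fun t ht => hd t ht.1)
    ((intervalIntegrable_iff_integrableOn_Ioc_of_le hT.le).2 (i1.add i2)) h0
    ((hd T hT).continuousAt.tendsto.mono_left nhdsWithin_le_nhds)
  rw [intervalIntegral.integral_of_le hT.le, integral_add i1 i2] at key
  linarith

variable {a : ℕ → ℝ} {k : ℕ} {c : ℝ}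

theorem tendsto_log_two_mul_ratio {t : ℝ} (ht : 0 < t) :
    Tendsto (fun X : ℝ => log (2 * (X * t)) / log (2 * X)) atTop (𝓝 1) := by
  have hl : Tendsto (fun X : ℝ => log (2 * X)) atTop atTop :=
    tendsto_log_atTop.comp (tendsto_id.const_mul_atTop two_pos)
  have h : Tendsto (fun X : ℝ => 1 + log t / log (2 * X)) atTop (𝓝 (1 + 0)) :=
    tendsto_const_nhds.add (hl.const_div_atTop _)
  rw [add_zero] at h
  refine h.congr' ?_
  filter_upwards [eventually_ge_atTop 1] with X hX
  have := log_two_mul_pos hX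
  rw [← mul_assoc, log_mul (by positivity) ht.ne']
  field_simp

theorem tendsto_partialSum_mul_div
    (hA : Tendsto (fun y => partialSum a y / (y * log (2 * y) ^ k)) atTop (𝓝 c))
    {t : ℝ} (ht : 0 < t) :
    Tendsto (fun X => partialSum a (X * t) / (X * log (2 * X) ^ k)) atTop (𝓝 (c * t)) := by
  have hXt : Tendsto (fun X : ℝ => X * t) atTop atTop := tendsto_id.atTop_mul_const ht
  have h := ((hA.comp hXt).mul ((tendsto_log_two_mul_ratio ht).pow k)).mul_const t
  rw [one_pow, mul_one] at h
  refine h.congr' ?_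
  filter_upwards [eventually_ge_atTop 1, hXt.eventually_ge_atTop 1] with X hX hX'
  have h1 := log_two_mul_pos hX
  have h2 := log_two_mul_pos hX'
  simp only [Function.comp_apply, div_pow]
  generalize log (2 * (X * t)) = u at *
  field_simp

/-- Asymptotics of the truncated sums `∑_{n ≤ X T} φ(n / X) a n`. -/
theorem tendsto_head (ha : ∀ n, 0 ≤ a n) (ha0 : a 0 = 0)
    (hA : Tendsto (fun y => partialSum a y / (y * log (2 * y) ^ k)) atTop (𝓝 c))
    (hp : 0 < p) {T : ℝ} (hT : 0 < T)
    (hφ : ∀ t, 0 < t → HasDerivAt φ (φ' t) t) (hc : ContinuousOn φ' (Set.Ioi 0))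
    (hb : ∀ t, 0 < t → |φ t| ≤ B * t ^ (p - 1))
    (hb' : ∀ t, 0 < t → |φ' t| ≤ B * t ^ (p - 2)) :
    Tendsto (fun X => (∑ n ∈ Finset.Icc 0 ⌊X * T⌋₊, φ (n / X) * a n) / (X * log (2 * X) ^ k))
      atTop (𝓝 (c * ∫ t in Set.Ioc 0 T, φ t)) := by
  obtain ⟨C, hC, hCb⟩ := exists_partialSum_mul_le ha ha0 hA one_pos
  have hB : 0 ≤ B := by simpa using (abs_nonneg _).trans (hb 1 one_pos)
  have hint : Tendsto (fun X => ∫ t in Set.Ioc 0 T,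
      φ' t * (partialSum a (X * t) / (X * log (2 * X) ^ k))) atTop
      (𝓝 (∫ t in Set.Ioc 0 T, φ' t * (c * t))) := by
    refine tendsto_integral_filter_of_dominated_convergence
      (fun t => B * C * (1 + T) * t ^ (p - 1)) ?_ ?_
      ((integrableOn_Ioc_rpow_sub_one hp hT.le).const_mul _) ?_
    · filter_upwards [eventually_ge_atTop 1] with X hX
      refine ((hc.mono Set.Ioc_subset_Ioi_self).aestronglyMeasurable measurableSet_Ioc).mul ?_
      have : Monotone fun t => partialSum a (X * t) := fun s t hst =>
        partialSum_mono ha (by gcongr)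
      exact (this.measurable.div_const _).aestronglyMeasurable
    · filter_upwards [eventually_ge_atTop 1] with X hX
      filter_upwards [ae_restrict_mem measurableSet_Ioc] with t ht
      have ht0 : 0 < t := ht.1
      have h1 := log_two_mul_pos hX
      have h2 : partialSum a (X * t) / (X * log (2 * X) ^ k) ≤ C * (t * (1 + T)) := by
        rw [div_le_iff₀ (by positivity)]
        calc _ ≤ C * (X * log (2 * X) ^ k) * (t * (1 + t) ^ (1 : ℝ)) := hCb X t hX ht0
          _ ≤ C * (X * log (2 * X) ^ k) * (t * (1 + T)) := by
            rw [rpow_one]; gcongr; exact ht.2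
          _ = _ := by ring
      have h3 : 0 ≤ partialSum a (X * t) / (X * log (2 * X) ^ k) :=
        div_nonneg (partialSum_nonneg ha _) (by positivity)
      rw [norm_mul, norm_eq_abs, norm_eq_abs, abs_of_nonneg h3]
      calc _ ≤ (B * t ^ (p - 2)) * (C * (t * (1 + T))) := by
            gcongr; exact hb' t ht0
        _ = _ := by
            rw [show p - 1 = 1 + (p - 2) by ring, rpow_add ht0, rpow_one]; ring
    · filter_upwards [ae_restrict_mem measurableSet_Ioc] with t ht
      exact (tendsto_partialSum_mul_div hA ht.1).const_mul _
  have hlim := ((tendsto_partialSum_mul_div hA hT).const_mul (φ T)).sub hint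
  have e : φ T * (c * T) - ∫ t in Set.Ioc 0 T, φ' t * (c * t) =
      c * ∫ t in Set.Ioc 0 T, φ t := by
    rw [integral_Ioc_eq_sub hp hT hφ hc hb hb']
    have : ∀ t, φ' t * (c * t) = c * (t * φ' t) := fun t => by ring
    simp only [this, integral_const_mul]
    ring
  rw [e] at hlim
  refine hlim.congr' ?_
  filter_upwards [eventually_ge_atTop (1 / T), eventually_ge_atTop 1] with X hX1 hX
  have hX0 : 0 < X := by linarith
  have hs : 0 < 1 / (2 * X) := by positivity
  have hXs : X * (1 / (2 * X)) = 1 / 2 := by field_simp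
  have hsT : 1 / (2 * X) ≤ T := by
    rw [div_le_iff₀ hT] at hX1
    rw [div_le_iff₀ (by positivity)]
    linarith
  have habel := sum_scaled_mul_eq (a := a) hX0 hs hsT hφ hc
  have hfl : ⌊(1 / 2 : ℝ)⌋₊ = 0 := Nat.floor_eq_zero.2 (by norm_num)
  rw [hXs, hfl, partialSum_of_lt_one ha0 (by norm_num : (1 / 2 : ℝ) < 1)] at habel
  rw [Finset.Icc_eq_cons_Ioc (Nat.zero_le _), Finset.sum_cons, habel, ha0]
  have : ∫ t in Set.Ioc (1 / (2 * X)) T, φ' t * partialSum a (X * t) =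
      ∫ t in Set.Ioc 0 T, φ' t * partialSum a (X * t) := by
    refine (setIntegral_eq_of_subset_of_forall_sdiff_eq_zero measurableSet_Ioc
      (Set.Ioc_subset_Ioc_left hs.le) fun t ht => ?_).symm
    have ht' : t ≤ 1 / (2 * X) := by
      by_contra! h
      exact ht.2 ⟨h, ht.1.2⟩
    have : X * t ≤ 1 / 2 := hXs ▸ (by gcongr)
    rw [partialSum_of_lt_one ha0 (by linarith), mul_zero]
  rw [this]
  simp only [← mul_div_assoc, integral_div]
  ring

theorem integrableOn_Ioi_of_abs_le (hp : 0 < p)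
    (hcφ : ContinuousOn φ (Set.Ioi 0)) (hb : ∀ t, 0 < t → |φ t| ≤ B * t ^ (p - 1))
    (hbt : ∀ t, 0 < t → |φ t| ≤ t ^ (-1 - p)) : IntegrableOn φ (Set.Ioi 0) := by
  rw [← Set.Ioc_union_Ioi_eq_Ioi zero_le_one]
  refine (integrableOn_Ioc_of_abs_le_rpow hp zero_le_one hcφ hb).union ?_
  refine Integrable.mono' (integrableOn_Ioi_rpow_of_lt (by linarith : -1 - p < -1) one_pos)
    ((hcφ.mono (Set.Ioi_subset_Ioi zero_le_one)).aestronglyMeasurable measurableSet_Ioi) ?_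
  filter_upwards [ae_restrict_mem measurableSet_Ioi] with t ht
  exact hbt t (one_pos.trans ht)

/-- Comparison of the full series with its truncation. -/
theorem exists_tsum_sub_head_le (ha : ∀ n, 0 ≤ a n) (ha0 : a 0 = 0)
    (hA : Tendsto (fun y => partialSum a y / (y * log (2 * y) ^ k)) atTop (𝓝 c))
    (hp : 0 < p) (hbt : ∀ t, 0 < t → |φ t| ≤ t ^ (-1 - p)) :
    ∃ C, 0 < C ∧ ∀ X T, 1 ≤ X → 1 ≤ T →
      |∑' n : ℕ, φ (n / X) * a n - ∑ n ∈ Finset.Icc 0 ⌊X * T⌋₊, φ (n / X) * a n| ≤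
        C * (X * log (2 * X) ^ k) * T ^ (-(p / 2)) := by
  obtain ⟨C, hC, hCb⟩ := exists_tail_le ha ha0 hA hp
  refine ⟨C, hC, fun X T hX hT => ?_⟩
  have hX0 : 0 < X := by linarith
  have hterm : ∀ n : ℕ, |φ (n / X) * a n| ≤ ((n : ℝ) / X) ^ (-1 - p) * a n := by
    intro n
    rcases Nat.eq_zero_or_pos n with rfl | hn
    · simp [ha0]
    · rw [abs_mul, abs_of_nonneg (ha n)]
      have : (0 : ℝ) < n := by exact_mod_cast hn
      exact mul_le_mul_of_nonneg_right (hbt _ (by positivity)) (ha n)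
  have htail : ∀ N, ∑ n ∈ Finset.Ioc ⌊X * T⌋₊ N, |φ (n / X) * a n| ≤
      C * (X * log (2 * X) ^ k) * T ^ (-(p / 2)) := fun N =>
    (Finset.sum_le_sum fun n _ => hterm n).trans (hCb X T hX hT N)
  have hsplit : ∀ (f : ℕ → ℝ) (M N : ℕ), M ≤ N → ∑ n ∈ Finset.range (N + 1), f n =
      ∑ n ∈ Finset.Icc 0 M, f n + ∑ n ∈ Finset.Ioc M N, f n := by
    intro f M N h
    rw [← Finset.sum_union]
    · congr 1
      ext n
      simp
      omega
    · refine Finset.disjoint_left.2 fun n h1 h2 => ?_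
      simp at h1 h2
      omega
  have hsum : Summable fun n : ℕ => φ (n / X) * a n := by
    refine Summable.of_abs (summable_of_sum_range_le
      (c := ∑ n ∈ Finset.Icc 0 ⌊X * T⌋₊, |φ (n / X) * a n| +
        C * (X * log (2 * X) ^ k) * T ^ (-(p / 2))) (fun n => abs_nonneg _) fun n => ?_)
    have h1 := hsplit (fun n => |φ (n / X) * a n|) ⌊X * T⌋₊ (⌊X * T⌋₊ + n) (by omega)
    have h2 : ∑ i ∈ Finset.range n, |φ (i / X) * a i| ≤
        ∑ i ∈ Finset.range (⌊X * T⌋₊ + n + 1), |φ (i / X) * a i| :=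
      Finset.sum_le_sum_of_subset_of_nonneg (Finset.range_mono (by omega))
        fun _ _ _ => abs_nonneg _
    linarith [htail (⌊X * T⌋₊ + n)]
  have hlim := ((((tendsto_add_atTop_iff_nat 1).2 hsum.hasSum.tendsto_sum_nat).sub_const
    (∑ n ∈ Finset.Icc 0 ⌊X * T⌋₊, φ (n / X) * a n))).abs
  refine le_of_tendsto hlim ?_
  filter_upwards [eventually_ge_atTop ⌊X * T⌋₊] with N hN
  rw [hsplit _ _ _ hN, add_sub_cancel_left]
  exact (Finset.abs_sum_le_sum_abs _ _).trans (htail N)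

/-- If `∑_{n ≤ y} a n ~ c y (log 2y)^k` and `φ` is a decaying kernel, then
`∑ φ(n / X) a n ~ c X (log 2X)^k ∫ φ`. -/
theorem tendsto_tsum_kernel (ha : ∀ n, 0 ≤ a n) (ha0 : a 0 = 0)
    (hA : Tendsto (fun y => partialSum a y / (y * log (2 * y) ^ k)) atTop (𝓝 c))
    (hp : 0 < p)
    (hφ : ∀ t, 0 < t → HasDerivAt φ (φ' t) t) (hc : ContinuousOn φ' (Set.Ioi 0))
    (hb : ∀ t, 0 < t → |φ t| ≤ B * t ^ (p - 1))
    (hb' : ∀ t, 0 < t → |φ' t| ≤ B * t ^ (p - 2))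
    (hbt : ∀ t, 0 < t → |φ t| ≤ t ^ (-1 - p)) :
    Tendsto (fun X => (∑' n : ℕ, φ (n / X) * a n) / (X * log (2 * X) ^ k))
      atTop (𝓝 (c * ∫ t in Set.Ioi 0, φ t)) := by
  obtain ⟨C, hC, hCb⟩ := exists_tsum_sub_head_le ha ha0 hA hp hbt
  have hcφ : ContinuousOn φ (Set.Ioi 0) := fun t ht =>
    (hφ t ht).continuousAt.continuousWithinAt
  have hI : Tendsto (fun T => c * ∫ t in Set.Ioc 0 T, φ t) atTop
      (𝓝 (c * ∫ t in Set.Ioi 0, φ t)) := by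
    refine Tendsto.const_mul c ((intervalIntegral_tendsto_integral_Ioi 0
      (integrableOn_Ioi_of_abs_le hp hcφ hb hbt) tendsto_id).congr' ?_)
    filter_upwards [eventually_ge_atTop 0] with T hT
    exact intervalIntegral.integral_of_le hT
  have hT0 : Tendsto (fun T : ℝ => C * T ^ (-(p / 2))) atTop (𝓝 0) := by
    simpa using (tendsto_rpow_neg_atTop (half_pos hp)).const_mul C
  rw [Metric.tendsto_nhds]
  intro ε hε
  obtain ⟨T, hT1, hTI, hTC⟩ := ((eventually_ge_atTop 1).and
    (((Metric.tendsto_nhds.1 hI) (ε / 3) (by positivity)).and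
      (hT0.eventually (gt_mem_nhds (show 0 < ε / 3 by positivity))))).exists
  have hhead := tendsto_head ha ha0 hA hp (one_pos.trans_le hT1) hφ hc hb hb'
  filter_upwards [(Metric.tendsto_nhds.1 hhead) (ε / 3) (by positivity),
    eventually_ge_atTop 1] with X hX hX1
  have hl := log_two_mul_pos hX1
  have hw : 0 < X * log (2 * X) ^ k := by positivity
  have h1 : |(∑' n : ℕ, φ (n / X) * a n) / (X * log (2 * X) ^ k) -
      (∑ n ∈ Finset.Icc 0 ⌊X * T⌋₊, φ (n / X) * a n) / (X * log (2 * X) ^ k)| < ε / 3 := by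
    rw [← sub_div, abs_div, abs_of_pos hw, div_lt_iff₀ hw]
    refine (hCb X T hX1 hT1).trans_lt ?_
    calc _ = C * T ^ (-(p / 2)) * (X * log (2 * X) ^ k) := by ring
      _ < _ := by gcongr
  rw [dist_eq] at hX hTI ⊢
  rw [abs_lt] at *
  constructor <;> linarith [h1.1, h1.2, hX.1, hX.2, hTI.1, hTI.2]

end Kernel

section SinSq

open MeasureTheory

/-- The kernel `sin² (π t ^ p) t ^ (-1 - p)`. -/
noncomputable def sinSqKernel (p t : ℝ) : ℝ := sin (π * t ^ p) ^ 2 * t ^ (-1 - p)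

/-- The derivative of `sinSqKernel p` on the positive half-line. -/
noncomputable def sinSqKernelDeriv (p t : ℝ) : ℝ :=
  2 * sin (π * t ^ p) * (cos (π * t ^ p) * (π * (p * t ^ (p - 1)))) * t ^ (-1 - p) +
    sin (π * t ^ p) ^ 2 * ((-1 - p) * t ^ (-1 - p - 1))

variable {p t : ℝ}

theorem hasDerivAt_sinSqKernel (ht : 0 < t) :
    HasDerivAt (sinSqKernel p) (sinSqKernelDeriv p t) t := by
  have h1 : HasDerivAt (fun t : ℝ => t ^ p) (p * t ^ (p - 1)) t :=
    hasDerivAt_rpow_const (Or.inl ht.ne')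
  have h2 : HasDerivAt (fun t : ℝ => t ^ (-1 - p)) ((-1 - p) * t ^ (-1 - p - 1)) t :=
    hasDerivAt_rpow_const (Or.inl ht.ne')
  simpa [sinSqKernelDeriv] using! ((h1.const_mul π).sin.pow 2).mul h2

theorem continuousOn_sinSqKernelDeriv : ContinuousOn (sinSqKernelDeriv p) (Set.Ioi 0) := by
  have h : ∀ q : ℝ, ContinuousOn (fun t : ℝ => t ^ q) (Set.Ioi 0) := fun q =>
    continuousOn_id.rpow_const fun t ht => Or.inl (ne_of_gt ht)
  have h1 := h p
  have h2 := h (p - 1)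
  have h3 := h (-1 - p)
  have h4 := h (-1 - p - 1)
  unfold sinSqKernelDeriv
  fun_prop

theorem abs_sinSqKernel_le_rpow_neg (ht : 0 < t) : |sinSqKernel p t| ≤ t ^ (-1 - p) := by
  have h := sin_sq_le_one (π * t ^ p)
  rw [sinSqKernel, abs_of_nonneg (by positivity)]
  exact mul_le_of_le_one_left (by positivity) h

theorem abs_sin_pi_mul_rpow_le (ht : 0 < t) : |sin (π * t ^ p)| ≤ π * t ^ p :=
  (abs_sin_le_abs).trans_eq (abs_of_nonneg (by positivity))

theorem sin_sq_pi_mul_rpow_le (ht : 0 < t) : sin (π * t ^ p) ^ 2 ≤ (π * t ^ p) ^ 2 := by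
  rw [← sq_abs]
  have := abs_sin_pi_mul_rpow_le (p := p) ht
  gcongr

theorem abs_sinSqKernel_le (ht : 0 < t) :
    |sinSqKernel p t| ≤ 4 * π ^ 2 * t ^ (p - 1) := by
  rw [sinSqKernel, abs_of_nonneg (by positivity)]
  have e : t ^ (p - 1) = t ^ p * t ^ p * t ^ (-1 - p) := by
    rw [← rpow_add ht, ← rpow_add ht]; congr 1; ring
  have h0 : 0 < t ^ (p - 1) := by positivity
  calc _ ≤ (π * t ^ p) ^ 2 * t ^ (-1 - p) := by
        gcongr ?_ * _; exact sin_sq_pi_mul_rpow_le ht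
    _ = π ^ 2 * t ^ (p - 1) := by rw [e]; ring
    _ ≤ _ := by gcongr; nlinarith [sq_nonneg π]

theorem abs_sinSqKernelDeriv_le (hp : 0 < p) (hp1 : p ≤ 1) (ht : 0 < t) :
    |sinSqKernelDeriv p t| ≤ 4 * π ^ 2 * t ^ (p - 2) := by
  have e1 : t ^ (p - 2) = t ^ p * t ^ (p - 1) * t ^ (-1 - p) := by
    rw [← rpow_add ht, ← rpow_add ht]; congr 1; ring
  have e2 : t ^ (p - 2) = t ^ p * t ^ p * t ^ (-1 - p - 1) := by
    rw [← rpow_add ht, ← rpow_add ht]; congr 1; ring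
  have h0 : 0 < t ^ (p - 2) := by positivity
  have b1 : |2 * sin (π * t ^ p) * (cos (π * t ^ p) * (π * (p * t ^ (p - 1)))) * t ^ (-1 - p)| ≤
      2 * π ^ 2 * p * t ^ (p - 2) := by
    have hpos : 0 ≤ π * (p * t ^ (p - 1)) := by positivity
    have hpos' : 0 ≤ t ^ (-1 - p) := by positivity
    rw [abs_mul, abs_mul, abs_mul, abs_two, abs_mul (cos _), abs_of_nonneg hpos,
      abs_of_nonneg hpos']
    calc _ ≤ 2 * (π * t ^ p) * (1 * (π * (p * t ^ (p - 1)))) * t ^ (-1 - p) := by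
          gcongr
          · exact abs_sin_pi_mul_rpow_le ht
          · exact abs_cos_le_one _
      _ = _ := by rw [e1]; ring
  have b2 : |sin (π * t ^ p) ^ 2 * ((-1 - p) * t ^ (-1 - p - 1))| ≤
      (1 + p) * π ^ 2 * t ^ (p - 2) := by
    have hpos : 0 ≤ t ^ (-1 - p - 1) := by positivity
    rw [abs_mul, abs_mul, abs_of_nonneg (sq_nonneg (sin _)), abs_of_nonneg hpos,
      show -1 - p = -(1 + p) by ring, abs_neg, abs_of_pos (by linarith : 0 < 1 + p)]
    rw [show -1 - p = -(1 + p) by ring] at e2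
    calc _ ≤ (π * t ^ p) ^ 2 * ((1 + p) * t ^ (-(1 + p) - 1)) := by
          gcongr ?_ * _; exact sin_sq_pi_mul_rpow_le ht
      _ = _ := by rw [e2]; ring
  have h1 : 0 < π ^ 2 * t ^ (p - 2) := by positivity
  refine (abs_add_le _ _).trans ((add_le_add b1 b2).trans ?_)
  nlinarith

theorem tendsto_tsum_sinSqKernel {a : ℕ → ℝ} {k : ℕ} {c : ℝ} (ha : ∀ n, 0 ≤ a n) (ha0 : a 0 = 0)
    (hA : Tendsto (fun y => partialSum a y / (y * log (2 * y) ^ k)) atTop (𝓝 c))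
    (hp : 0 < p) (hp1 : p ≤ 1) :
    Tendsto (fun X => (∑' n : ℕ, sinSqKernel p (n / X) * a n) / (X * log (2 * X) ^ k))
      atTop (𝓝 (c * ∫ t in Set.Ioi 0, sinSqKernel p t)) :=
  tendsto_tsum_kernel ha ha0 hA hp (fun _ => hasDerivAt_sinSqKernel)
    continuousOn_sinSqKernelDeriv (fun _ => abs_sinSqKernel_le)
    (fun _ => abs_sinSqKernelDeriv_le hp hp1) (fun _ => abs_sinSqKernel_le_rpow_neg)

theorem tsum_sin_sq_div_sq {x : ℝ} (hx : x ∈ Set.Icc (0 : ℝ) 1) :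
    ∑' n : ℕ, sin (π * n * x) ^ 2 / (n : ℝ) ^ 2 = π ^ 2 / 2 * (x - x ^ 2) := by
  have hB : ∀ y : ℝ, ((Polynomial.bernoulli 2).map (algebraMap ℚ ℝ)).eval y =
      y ^ 2 - y + 1 / 6 := by
    intro y
    simp [Polynomial.bernoulli, Finset.sum_range_succ, Polynomial.eval_add, bernoulli_one,
      bernoulli_two]
    ring
  have h0 := hasSum_one_div_nat_pow_mul_cos one_ne_zero (Set.left_mem_Icc.2 zero_le_one)
  have h1 := hasSum_one_div_nat_pow_mul_cos one_ne_zero hx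
  have h := (h0.sub h1).div_const 2
  simp only [mul_one, hB] at h
  convert h.tsum_eq using 1
  · refine tsum_congr fun n => ?_
    rw [sin_sq_eq_half_sub, mul_zero, cos_zero, show 2 * (π * n * x) = 2 * π * n * x by ring]
    ring
  · norm_num [Nat.factorial]
    ring

theorem integral_sinSqKernel_one : ∫ t in Set.Ioi 0, sinSqKernel 1 t = π ^ 2 / 2 := by
  set a : ℕ → ℝ := fun n => if n = 0 then 0 else 1 with ha
  have hP : ∀ y, partialSum a y = (⌊y⌋₊ : ℝ) := by
    intro y
    rw [partialSum, Finset.Icc_eq_cons_Ioc (Nat.zero_le _), Finset.sum_cons,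
      Finset.sum_congr rfl (g := fun _ => (1 : ℝ))]
    · simp [ha]
    · intro n hn
      simp [ha, (Finset.mem_Ioc.1 hn).1.ne']
  have hA : Tendsto (fun y => partialSum a y / (y * log (2 * y) ^ 0)) atTop (𝓝 1) := by
    simpa [hP] using tendsto_nat_floor_div_atTop (R := ℝ)
  have h := tendsto_tsum_sinSqKernel (fun n => by simp only [ha]; split_ifs <;> norm_num)
    (by simp [ha]) hA one_pos le_rfl
  rw [one_mul] at h
  have h2 : Tendsto (fun X : ℝ => π ^ 2 / 2 * (1 - 1 / X)) atTop (𝓝 (π ^ 2 / 2 * (1 - 0))) :=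
    (tendsto_const_nhds.sub (tendsto_const_nhds.div_atTop tendsto_id)).const_mul _
  rw [sub_zero, mul_one] at h2
  refine tendsto_nhds_unique h (h2.congr' ?_)
  filter_upwards [eventually_ge_atTop 1] with X hX
  have hX0 : 0 < X := by linarith
  have e : ∀ n : ℕ, sinSqKernel 1 (n / X) * a n =
      X ^ 2 * (sin (π * n * (1 / X)) ^ 2 / (n : ℝ) ^ 2) := by
    intro n
    rcases Nat.eq_zero_or_pos n with rfl | hn
    · simp [ha]
    · have hn' : (0 : ℝ) < n := by exact_mod_cast hn
      have : ((n : ℝ) / X) ^ (-1 - 1 : ℝ) = X ^ 2 / (n : ℝ) ^ 2 := by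
        rw [show (-1 - 1 : ℝ) = -((2 : ℕ) : ℝ) by norm_num, rpow_neg (by positivity),
          rpow_natCast, div_pow, inv_div]
      simp only [sinSqKernel, this, rpow_one, ha, hn.ne', if_false]
      rw [show π * (n / X) = π * n * (1 / X) by ring]
      ring
  simp only [e, tsum_mul_left]
  rw [tsum_sin_sq_div_sq ⟨by positivity, by rw [div_le_one hX0]; exact hX⟩]
  field_simp

theorem integral_sinSqKernel (hp : 0 < p) :
    ∫ t in Set.Ioi 0, sinSqKernel p t = π ^ 2 / (2 * p) := by
  have h := integral_comp_rpow_Ioi_of_pos (g := sinSqKernel 1) hp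
  rw [integral_sinSqKernel_one] at h
  have e : ∀ t ∈ Set.Ioi (0 : ℝ), (p * t ^ (p - 1)) • sinSqKernel 1 (t ^ p) =
      p * sinSqKernel p t := by
    intro t ht
    have ht : 0 < t := ht
    have : t ^ (-1 - p) = t ^ (p - 1) * (t ^ p) ^ (-1 - 1 : ℝ) := by
      rw [← rpow_mul ht.le, ← rpow_add ht]; congr 1; ring
    rw [smul_eq_mul, sinSqKernel, sinSqKernel, rpow_one, this]
    ring
  rw [setIntegral_congr_fun measurableSet_Ioi e, integral_const_mul] at h
  field_simp
  linarith

end SinSq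

/-- Under a Rankin–Selberg type partial sum estimate, the variance series
`(2/π²) Σ_{n≥1} (λ(n)²/n)·sin²(π n̆ δ)/n̆` is asymptotic to
`c·m^r·δ·(log(1/δ))^{r-1}` as `δ → 0⁺`, where `n̆ = m (n/D)^{1/m}`. -/
theorem variance_asymptotic
    (m r : ℕ) (hm : 2 ≤ m) (hr : 1 ≤ r) (D c : ℝ) (hD : 0 < D) (hc : 0 < c)
    (lam : ℕ → ℝ)
    (hRS : Tendsto
      (fun y : ℝ => (∑ n ∈ Finset.Icc 1 ⌊y⌋₊, (lam n) ^ 2) /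
        (y * (Real.log (2 * y)) ^ (r - 1))) atTop (𝓝 c)) :
    Tendsto
      (fun δ : ℝ =>
        ((2 / π ^ 2) * ∑' n : ℕ,
            ((lam (n + 1)) ^ 2 / (n + 1 : ℝ)) *
              (Real.sin (π * (m * (((n + 1 : ℕ) : ℝ) / D) ^ ((1 : ℝ) / m)) * δ)) ^ 2 /
                (m * (((n + 1 : ℕ) : ℝ) / D) ^ ((1 : ℝ) / m))) /
          ((m : ℝ) ^ r * δ * (Real.log (1 / δ)) ^ (r - 1)))
      (𝓝[>] 0) (𝓝 c) := by
  obtain ⟨k, rfl⟩ : ∃ k, r = k + 1 := ⟨r - 1, by omega⟩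
  rw [Nat.add_sub_cancel] at *
  have hm0 : (0 : ℝ) < m := by exact_mod_cast (by omega : 0 < m)
  have hp : (0 : ℝ) < 1 / m := by positivity
  have hp1 : (1 : ℝ) / m ≤ 1 := by
    rw [div_le_one hm0]; exact_mod_cast (by omega : 1 ≤ m)
  set a : ℕ → ℝ := fun n => if n = 0 then 0 else lam n ^ 2 with ha
  have hP : ∀ y, partialSum a y = ∑ n ∈ Finset.Icc 1 ⌊y⌋₊, lam n ^ 2 := by
    intro y
    rw [partialSum, Finset.Icc_eq_cons_Ioc (Nat.zero_le _), Finset.sum_cons,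
      ← Finset.Icc_add_one_left_eq_Ioc, zero_add]
    simp only [ha, if_true, zero_add]
    refine Finset.sum_congr rfl fun n hn => ?_
    rw [if_neg (by have := (Finset.mem_Icc.1 hn).1; omega)]
  have hA : Tendsto (fun y => partialSum a y / (y * log (2 * y) ^ k)) atTop (𝓝 c) := by
    simpa only [hP] using hRS
  have hmain := tendsto_tsum_sinSqKernel
    (fun n => by simp only [ha]; split_ifs <;> positivity) (by simp [ha]) hA hp hp1
  rw [integral_sinSqKernel hp] at hmain
  set X : ℝ → ℝ := fun δ => D / (m * δ) ^ m with hX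
  have hid : Tendsto (fun δ : ℝ => δ) (𝓝[>] 0) (𝓝 0) := tendsto_id.mono_left nhdsWithin_le_nhds
  have hXtop : Tendsto X (𝓝[>] 0) atTop := by
    have h1 : Tendsto (fun δ : ℝ => (m * δ) ^ m) (𝓝[>] 0) (𝓝[>] 0) := by
      refine tendsto_nhdsWithin_iff.2 ⟨?_, ?_⟩
      · simpa [show m ≠ 0 by omega] using (hid.const_mul (m : ℝ)).pow m
      · filter_upwards [self_mem_nhdsWithin] with δ hδ
        have hδ : 0 < δ := hδ
        exact Set.mem_Ioi.2 (by positivity)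
    simpa [hX, div_eq_mul_inv] using (tendsto_inv_nhdsGT_zero.comp h1).const_mul_atTop hD
  have hL : Tendsto (fun δ : ℝ => log (1 / δ)) (𝓝[>] 0) atTop := by
    simpa only [one_div, Function.comp_def] using tendsto_log_atTop.comp (tendsto_inv_nhdsGT_zero (𝕜 := ℝ))
  have hratio : Tendsto (fun δ => log (2 * X δ) / log (1 / δ)) (𝓝[>] 0) (𝓝 m) := by
    have h : Tendsto (fun δ => log (2 * D / (m : ℝ) ^ m) / log (1 / δ) + m) (𝓝[>] 0)
        (𝓝 (0 + m)) := (hL.const_div_atTop _).add_const _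
    rw [zero_add] at h
    refine h.congr' ?_
    filter_upwards [self_mem_nhdsWithin, hL.eventually_gt_atTop 0] with δ hδ hl
    have hδ : 0 < δ := hδ
    have e : 2 * X δ = 2 * D / (m : ℝ) ^ m * (1 / δ) ^ m := by
      simp only [hX, mul_pow, div_pow, one_pow]
      field_simp
    rw [e, log_mul (by positivity) (by positivity), log_pow]
    field_simp
  have hlim := ((hmain.comp hXtop).mul (hratio.pow k)).mul_const (2 / π ^ 2 / (m : ℝ) ^ (k + 1))
  have hval : c * (π ^ 2 / (2 * (1 / m))) * (m : ℝ) ^ k * (2 / π ^ 2 / (m : ℝ) ^ (k + 1)) = c := by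
    field_simp
    ring
  rw [hval] at hlim
  refine hlim.congr' ?_
  filter_upwards [self_mem_nhdsWithin, hXtop.eventually_ge_atTop 1] with δ hδ hX1
  have hδ : 0 < δ := hδ
  have hX0 : 0 < X δ := by linarith
  have hl := log_two_mul_pos hX1
  have hshift : ∑' n : ℕ, sinSqKernel (1 / m) (n / X δ) * a n =
      ∑' n : ℕ, sinSqKernel (1 / m) ((n + 1 : ℕ) / X δ) * a (n + 1) := by
    refine ((add_left_injective 1).tsum_eq fun n hn => ?_).symm
    rcases n with _ | n
    · simp [ha] at hn
    · exact ⟨n, rfl⟩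
  have hterm : ∀ n : ℕ, ((lam (n + 1)) ^ 2 / (n + 1 : ℝ)) *
      (Real.sin (π * (m * (((n + 1 : ℕ) : ℝ) / D) ^ ((1 : ℝ) / m)) * δ)) ^ 2 /
        (m * (((n + 1 : ℕ) : ℝ) / D) ^ ((1 : ℝ) / m)) =
      δ / X δ * (sinSqKernel (1 / m) ((n + 1 : ℕ) / X δ) * a (n + 1)) := by
    intro n
    have hn : (0 : ℝ) < (n + 1 : ℕ) := by positivity
    have hroot : (((n + 1 : ℕ) : ℝ) / X δ) ^ ((1 : ℝ) / m) =
        m * (((n + 1 : ℕ) : ℝ) / D) ^ ((1 : ℝ) / m) * δ := by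
      have e : ((n + 1 : ℕ) : ℝ) / X δ = ((n + 1 : ℕ) : ℝ) / D * (m * δ) ^ m := by
        simp only [hX]; field_simp
      rw [e, mul_rpow (by positivity) (by positivity), one_div,
        pow_rpow_inv_natCast (by positivity) (by omega)]
      ring
    have hpow : (((n + 1 : ℕ) : ℝ) / X δ) ^ (-1 - (1 : ℝ) / m) =
        X δ / (n + 1 : ℕ) * (m * (((n + 1 : ℕ) : ℝ) / D) ^ ((1 : ℝ) / m) * δ)⁻¹ := by
      rw [sub_eq_add_neg, rpow_add (by positivity), rpow_neg_one, inv_div,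
        rpow_neg (by positivity), hroot]
    rw [sinSqKernel, hpow, hroot, ← mul_assoc π]
    simp only [ha, Nat.succ_ne_zero, if_false]
    push_cast
    field_simp
  simp only [hterm, tsum_mul_left, ← hshift, Function.comp_apply, div_pow]
  generalize log (1 / δ) ^ k = L
  generalize log (2 * X δ) = l at hl
  field_simp
end

section
/- Let m ≥ 2 and r ≥ 1 be integers and D > 0 a real number. Then, as δ → 0⁺, the ratio [(2/π²) ∫_1^∞ sin²(π m (y/D)^{1/m} δ) / (m (y/D)^{1/m} y) · (log y)^{r−1} dy] / [m^r δ (log(1/δ))^{r−1}] converges to 1. -/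
open Real Filter Topology MeasureTheory

/-- Powers of `A + |log u|` grow slower than `u ^ (±1/2)` at infinity and at zero, respectively. -/
theorem exists_add_abs_log_pow_le {A : ℝ} (hA : 0 ≤ A) (k : ℕ) :
    ∃ K : ℝ, 0 ≤ K ∧ (∀ u : ℝ, 1 ≤ u → (A + |log u|) ^ k ≤ K * u ^ (1 / 2 : ℝ)) ∧
      ∀ u : ℝ, 0 < u → u ≤ 1 → (A + |log u|) ^ k ≤ K * u ^ (-(1 / 2) : ℝ) := by
  set ε : ℝ := 1 / (2 * (k + 1)) with hε
  have hε0 : 0 < ε := by positivity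
  have hεk : ε * k ≤ 1 / 2 := by
    rw [hε, div_mul_eq_mul_div, div_le_div_iff₀ (by positivity) (by positivity)]
    linarith
  have key : ∀ u : ℝ, 1 ≤ u → (A + |log u|) ^ k ≤ (A + 1 / ε) ^ k * u ^ (1 / 2 : ℝ) := by
    intro u hu
    have hu0 : 0 < u := by linarith
    have h1 : 1 ≤ u ^ ε := one_le_rpow hu hε0.le
    have h2 : A + |log u| ≤ (A + 1 / ε) * u ^ ε := by
      rw [abs_of_nonneg (log_nonneg hu)]
      have := log_le_rpow_div hu0.le hε0
      have h3 : u ^ ε / ε = 1 / ε * u ^ ε := by ring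
      nlinarith
    calc (A + |log u|) ^ k ≤ ((A + 1 / ε) * u ^ ε) ^ k := by gcongr
      _ = (A + 1 / ε) ^ k * u ^ (ε * k) := by
        rw [mul_pow, rpow_mul hu0.le, rpow_natCast]
      _ ≤ _ := by gcongr
  refine ⟨(A + 1 / ε) ^ k, by positivity, key, fun u hu hu1 => ?_⟩
  have := key u⁻¹ ((one_le_inv₀ hu).2 hu1)
  rwa [log_inv, abs_neg, inv_rpow hu.le, ← rpow_neg hu.le] at this

theorem integrableOn_sin_sq_div_sq_mul_log_pow {c A : ℝ} (hA : 0 ≤ A) (k : ℕ) :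
    IntegrableOn (fun u : ℝ => sin (c * u) ^ 2 / u ^ 2 * (A + |log u|) ^ k) (Set.Ioi 0) := by
  obtain ⟨K, hK, h1, h2⟩ := exists_add_abs_log_pow_le hA k
  have hm : Measurable (fun u : ℝ => sin (c * u) ^ 2 / u ^ 2 * (A + |log u|) ^ k) := by
    fun_prop
  rw [← Set.Ioc_union_Ioi_eq_Ioi zero_le_one]
  refine IntegrableOn.union ?_ ?_
  · have hi : IntegrableOn (fun u : ℝ => c ^ 2 * (K * u ^ (-(1 / 2) : ℝ))) (Set.Ioc 0 1) := by
      rw [← intervalIntegrable_iff_integrableOn_Ioc_of_le zero_le_one]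
      exact ((intervalIntegral.intervalIntegrable_rpow' (by norm_num)).const_mul _).const_mul _
    refine hi.mono' hm.aestronglyMeasurable ?_
    filter_upwards [ae_restrict_mem measurableSet_Ioc] with u hu
    rw [norm_of_nonneg (by positivity)]
    have := h2 u hu.1 hu.2
    gcongr
    rw [div_le_iff₀ (pow_pos hu.1 2), ← mul_pow]
    exact sin_sq_le_sq
  · have hi : IntegrableOn (fun u : ℝ => K * u ^ (-(3 / 2) : ℝ)) (Set.Ioi 1) :=
      (integrableOn_Ioi_rpow_of_lt (by norm_num) one_pos).const_mul _
    refine hi.mono' hm.aestronglyMeasurable ?_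
    filter_upwards [ae_restrict_mem measurableSet_Ioi] with u hu
    have hu0 : 0 < u := one_pos.trans hu
    rw [norm_of_nonneg (by positivity)]
    calc sin (c * u) ^ 2 / u ^ 2 * (A + |log u|) ^ k
        ≤ 1 / u ^ 2 * (K * u ^ (1 / 2 : ℝ)) := by
          gcongr
          · exact sin_sq_le_one _
          · exact h1 u (le_of_lt hu)
      _ = K * u ^ (-(3 / 2) : ℝ) := by
          rw [show (-(3 / 2) : ℝ) = 1 / 2 - (2 : ℕ) by norm_num, rpow_sub_natCast hu0.ne']
          ring

theorem integral_mul_exp_neg_mul_Ioi {u : ℝ} (hu : 0 < u) :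
    ∫ t in Set.Ioi (0 : ℝ), t * exp (-(u * t)) = 1 / u ^ 2 := by
  have := Real.integral_rpow_mul_exp_neg_mul_Ioi (a := 2) two_pos hu
  norm_num [Real.Gamma_two] at this
  simpa using this

/-- The Laplace transform of `sin ^ 2`. -/
theorem integral_sin_sq_mul_exp_neg_mul_Ioi {t : ℝ} (ht : 0 < t) :
    ∫ u in Set.Ioi (0 : ℝ), sin u ^ 2 * exp (-(u * t)) = 2 / (t * (t ^ 2 + 4)) := by
  set F : ℝ → ℝ := fun u =>
    exp (-(u * t)) * (-(1 / (2 * t)) - (2 * sin (2 * u) - t * cos (2 * u)) / (2 * (t ^ 2 + 4)))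
    with hF
  have hd : ∀ u ∈ Set.Ici (0 : ℝ), HasDerivAt F (sin u ^ 2 * exp (-(u * t))) u := by
    intro u _
    have e : HasDerivAt (fun u => exp (-(u * t))) (exp (-(u * t)) * (-(1 * t))) u :=
      ((hasDerivAt_id u).mul_const t).neg.exp
    have l : HasDerivAt (fun u : ℝ => 2 * u) 2 u := by simpa using (hasDerivAt_id u).const_mul 2
    have s := (l.sin.const_mul 2).sub (l.cos.const_mul t)
    have := e.mul ((s.div_const (2 * (t ^ 2 + 4))).const_sub (-(1 / (2 * t))))
    convert! this using 1
    rw [sin_sq_eq_half_sub]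
    simp
    field_simp
    ring
  have hlim : Tendsto F atTop (𝓝 0) := by
    have he : Tendsto (fun u : ℝ => exp (-(u * t))) atTop (𝓝 0) :=
      tendsto_exp_neg_atTop_nhds_zero.comp (tendsto_id.atTop_mul_const ht)
    refine he.zero_mul_isBoundedUnder_le ?_
    refine isBoundedUnder_of ⟨1 / (2 * t) + (2 + t) / (2 * (t ^ 2 + 4)), fun u => ?_⟩
    have hs := abs_le.1 (abs_sin_le_one (2 * u))
    have hc := abs_le.1 (abs_cos_le_one (2 * u))
    have : |2 * sin (2 * u) - t * cos (2 * u)| ≤ 2 + t := by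
      rw [abs_le]; constructor <;> nlinarith
    simp only [Function.comp, norm_eq_abs]
    refine (abs_sub _ _).trans ?_
    rw [abs_neg, abs_of_pos (by positivity : 0 < 1 / (2 * t)), abs_div,
      abs_of_pos (by positivity : 0 < 2 * (t ^ 2 + 4))]
    gcongr
  rw [integral_Ioi_of_hasDerivAt_of_nonneg' hd (fun u _ => by positivity) hlim, hF]
  simp
  field_simp
  ring

theorem integral_two_div_sq_add_four_Ioi :
    ∫ t in Set.Ioi (0 : ℝ), 2 / (t ^ 2 + 4) = π / 2 := by
  have hd : ∀ t ∈ Set.Ici (0 : ℝ), HasDerivAt (fun t => arctan (t / 2)) (2 / (t ^ 2 + 4)) t := by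
    intro t _
    convert! ((hasDerivAt_id t).div_const 2).arctan using 1
    simp
    field_simp
    ring
  have hlim : Tendsto (fun t : ℝ => arctan (t / 2)) atTop (𝓝 (π / 2)) :=
    (tendsto_arctan_atTop.mono_right nhdsWithin_le_nhds).comp
      (tendsto_id.atTop_div_const two_pos)
  rw [integral_Ioi_of_hasDerivAt_of_nonneg' hd (fun t _ => by positivity) hlim]
  simp

theorem integral_sin_sq_div_sq_Ioi :
    ∫ u in Set.Ioi (0 : ℝ), sin u ^ 2 / u ^ 2 = π / 2 := by
  set H : ℝ → ℝ → ℝ := fun u t => sin u ^ 2 * (t * exp (-(u * t))) with hH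
  have hu : ∀ u ∈ Set.Ioi (0 : ℝ), ∫ t in Set.Ioi 0, H u t = sin u ^ 2 / u ^ 2 := by
    intro u hu
    rw [integral_const_mul, integral_mul_exp_neg_mul_Ioi hu, mul_one_div]
  have ht : ∀ t ∈ Set.Ioi (0 : ℝ), ∫ u in Set.Ioi 0, H u t = 2 / (t ^ 2 + 4) := by
    intro t ht
    have ht0 : t ≠ 0 := ne_of_gt ht
    have : ∀ u, H u t = t * (sin u ^ 2 * exp (-(u * t))) := fun u => by simp only [hH]; ring
    simp_rw [this]
    rw [integral_const_mul, integral_sin_sq_mul_exp_neg_mul_Ioi ht]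
    field_simp
  have hint : Integrable (Function.uncurry H)
      ((volume.restrict (Set.Ioi 0)).prod (volume.restrict (Set.Ioi 0))) := by
    have hm : Measurable (Function.uncurry H) := by
      simp only [hH, Function.uncurry_def]; fun_prop
    rw [integrable_prod_iff hm.aestronglyMeasurable]
    constructor
    · filter_upwards [ae_restrict_mem measurableSet_Ioi] with u hu
      have h : Integrable (fun t => t * exp (-(u * t))) (volume.restrict (Set.Ioi 0)) := by
        refine .of_integral_ne_zero ?_
        rw [integral_mul_exp_neg_mul_Ioi hu]
        have : u ≠ 0 := ne_of_gt hu
        positivity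
      exact h.const_mul (sin u ^ 2)
    · have := integrableOn_sin_sq_div_sq_mul_log_pow (c := 1) le_rfl 0
      simp only [one_mul, pow_zero, mul_one] at this
      refine this.congr_fun (fun u h => ?_) measurableSet_Ioi
      refine (hu u h).symm.trans ?_
      refine setIntegral_congr_fun measurableSet_Ioi fun t (ht : 0 < t) => ?_
      simp only [hH, Function.uncurry_apply_pair]
      rw [norm_of_nonneg (by positivity)]
  rw [← setIntegral_congr_fun measurableSet_Ioi hu, integral_integral_swap hint,
    setIntegral_congr_fun measurableSet_Ioi ht, integral_two_div_sq_add_four_Ioi]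

theorem integral_sin_pi_mul_sq_div_sq_Ioi :
    ∫ u in Set.Ioi (0 : ℝ), sin (π * u) ^ 2 / u ^ 2 = π ^ 2 / 2 := by
  have h := integral_comp_mul_left_Ioi (fun u : ℝ => sin u ^ 2 / u ^ 2) 0 pi_pos
  rw [mul_zero, integral_sin_sq_div_sq_Ioi] at h
  have e : ∀ u : ℝ, sin (π * u) ^ 2 / u ^ 2 = π ^ 2 * (sin (π * u) ^ 2 / (π * u) ^ 2) := by
    intro u
    rw [mul_pow, ← mul_div_assoc, mul_div_mul_left _ _ (by positivity)]
  simp_rw [e]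
  rw [integral_const_mul, h, smul_eq_mul]
  field_simp

/-- The substitution `y = D * (u / c) ^ m` on the positive half-line. -/
theorem integral_Ioi_comp_mul_div_pow (g : ℝ → ℝ) {m : ℕ} (hm : m ≠ 0) {D c : ℝ} (hD : 0 < D)
    (hc : 0 < c) :
    ∫ y in Set.Ioi (0 : ℝ), g y =
      ∫ u in Set.Ioi (0 : ℝ), m / u * (D * (u / c) ^ m) * g (D * (u / c) ^ m) := by
  have hmR : (0 : ℝ) < m := by positivity
  have h1 := integral_comp_mul_left_Ioi' g 0 hD
  have h2 := integral_comp_rpow_Ioi_of_pos (g := fun x => g (D * x)) hmR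
  have h3 := integral_comp_mul_left_Ioi
    (fun x => ((m : ℝ) * x ^ ((m : ℝ) - 1)) • g (D * x ^ (m : ℝ))) 0 (inv_pos.2 hc)
  rw [mul_zero] at h1 h3
  rw [← h1, ← h2]
  rw [inv_inv, smul_eq_mul] at h3
  rw [← mul_right_inj' hc.ne', smul_eq_mul, mul_left_comm, ← h3, ← integral_const_mul,
    ← integral_const_mul]
  refine setIntegral_congr_fun measurableSet_Ioi fun u (hu : 0 < u) => ?_
  have hv : c⁻¹ * u = u / c := by ring
  have hp : 0 < u / c := by positivity
  simp only [hv, smul_eq_mul]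
  rw [rpow_sub_one hp.ne', rpow_natCast]
  field_simp

/-- The main-term integral after the substitution `u = m * (y / D) ^ (1 / m) * δ`. -/
theorem main_term_integral_eq (m k : ℕ) (hm : m ≠ 0) {D δ : ℝ} (hD : 0 < D) (hδ : 0 < δ) :
    ∫ y in Set.Ici (1 : ℝ), (sin (π * (m * (y / D) ^ ((1 : ℝ) / m)) * δ)) ^ 2 /
        ((m * (y / D) ^ ((1 : ℝ) / m)) * y) * (log y) ^ k =
      m * δ * ∫ u in Set.Ioi (0 : ℝ), {u : ℝ | 1 < D * (u / (m * δ)) ^ m}.indicator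
        (fun u => sin (π * u) ^ 2 / u ^ 2 * log (D * (u / (m * δ)) ^ m) ^ k) u := by
  have hmR : (0 : ℝ) < m := by positivity
  have hc : 0 < m * δ := by positivity
  rw [integral_Ici_eq_integral_Ioi]
  set f : ℝ → ℝ := fun y => (sin (π * (m * (y / D) ^ ((1 : ℝ) / m)) * δ)) ^ 2 /
        ((m * (y / D) ^ ((1 : ℝ) / m)) * y) * (log y) ^ k with hf
  have h0 : ∫ y in Set.Ioi (1 : ℝ), f y = ∫ y in Set.Ioi (0 : ℝ), (Set.Ioi 1).indicator f y := by
    rw [setIntegral_indicator measurableSet_Ioi, Set.Ioi_inter_Ioi]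
    simp
  rw [h0, integral_Ioi_comp_mul_div_pow _ hm hD hc, ← integral_const_mul]
  refine setIntegral_congr_fun measurableSet_Ioi fun u (hu : 0 < u) => ?_
  by_cases h : 1 < D * (u / (m * δ)) ^ m
  · have hp : 0 < u / (m * δ) := by positivity
    have hroot : (D * (u / (m * δ)) ^ m / D) ^ ((1 : ℝ) / m) = u / (m * δ) := by
      rw [mul_div_cancel_left₀ _ hD.ne', one_div, pow_rpow_inv_natCast hp.le hm]
    simp only [Set.indicator, Set.mem_Ioi, Set.mem_ofPred_eq, h, if_true, hf, hroot]
    rw [show π * (m * (u / (m * δ))) * δ = π * u by field_simp]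
    field_simp
  · simp [Set.indicator, h]

theorem log_mul_div_pow {m : ℕ} (hm : m ≠ 0) {D δ u : ℝ} (hD : 0 < D) (hδ : 0 < δ) (hu : 0 < u) :
    log (D * (u / (m * δ)) ^ m) = m * log (1 / δ) + (log D - m * log m) + m * log u := by
  have hmR : (0 : ℝ) < m := by positivity
  rw [log_mul hD.ne' (by positivity), log_pow, log_div hu.ne' (by positivity),
    log_mul hmR.ne' hδ.ne', one_div, log_inv]
  ring

/-- The main-term integral `(2/π²)∫_1^∞ sin²(π m (y/D)^{1/m} δ)/(m (y/D)^{1/m} y)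
·(log y)^{r-1} dy` is asymptotic to `m^r δ (log(1/δ))^{r-1}` as `δ → 0⁺`. -/
theorem main_term_integral_asymptotic
    (m r : ℕ) (hm : 2 ≤ m) (hr : 1 ≤ r) (D : ℝ) (hD : 0 < D) :
    Tendsto
      (fun δ : ℝ =>
        ((2 / π ^ 2) * ∫ y in Set.Ici (1 : ℝ),
            (Real.sin (π * (m * (y / D) ^ ((1 : ℝ) / m)) * δ)) ^ 2 /
              ((m * (y / D) ^ ((1 : ℝ) / m)) * y) * (Real.log y) ^ (r - 1)) /
          ((m : ℝ) ^ r * δ * (Real.log (1 / δ)) ^ (r - 1)))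
      (𝓝[>] 0) (𝓝 1) := by
  obtain ⟨k, rfl⟩ : ∃ k, r = k + 1 := ⟨r - 1, by omega⟩
  rw [Nat.add_sub_cancel]
  have hm0 : m ≠ 0 := by omega
  have hmR : (1 : ℝ) ≤ m := by exact_mod_cast (by omega : 1 ≤ m)
  have hL : Tendsto (fun δ : ℝ => log (1 / δ)) (𝓝[>] 0) atTop := by
    simp_rw [one_div]
    exact tendsto_log_atTop.comp tendsto_inv_nhdsGT_zero
  have hpos : ∀ᶠ δ : ℝ in 𝓝[>] 0, 0 < δ := eventually_mem_nhdsWithin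
  set B : ℝ := log D - m * log m with hB
  set Φ : ℝ → ℝ → ℝ := fun δ => {u : ℝ | 1 < D * (u / (m * δ)) ^ m}.indicator
    (fun u => sin (π * u) ^ 2 / u ^ 2 *
      (log (D * (u / (m * δ)) ^ m) / (m * log (1 / δ))) ^ k) with hΦ
  have hlim : Tendsto (fun δ => ∫ u in Set.Ioi (0 : ℝ), Φ δ u) (𝓝[>] 0)
      (𝓝 (∫ u in Set.Ioi (0 : ℝ), sin (π * u) ^ 2 / u ^ 2)) := by
    refine tendsto_integral_filter_of_dominated_convergence
      (fun u => sin (π * u) ^ 2 / u ^ 2 * (1 + |B| + |log u|) ^ k) ?_ ?_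
      (integrableOn_sin_sq_div_sq_mul_log_pow (by positivity) k) ?_
    · refine .of_forall fun δ => Measurable.aestronglyMeasurable ?_
      refine Measurable.indicator (by fun_prop) (measurableSet_lt ?_ ?_) <;> fun_prop
    · filter_upwards [hpos, hL.eventually_ge_atTop 1] with δ hδ hL1
      filter_upwards [ae_restrict_mem measurableSet_Ioi] with u (hu : 0 < u)
      by_cases h : 1 < D * (u / (m * δ)) ^ m
      · have hlog := log_pos h
        have hmL : 1 ≤ m * log (1 / δ) := one_le_mul_of_one_le_of_one_le hmR hL1
        simp only [hΦ, Set.indicator, Set.mem_ofPred_eq, h, if_true]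
        rw [norm_of_nonneg (by positivity)]
        gcongr
        rw [div_le_iff₀ (by positivity), log_mul_div_pow hm0 hD hδ hu]
        have h1 : B ≤ |B| * (m * log (1 / δ)) :=
          (le_abs_self B).trans (le_mul_of_one_le_right (abs_nonneg B) hmL)
        have h2 : m * log u ≤ |log u| * (m * log (1 / δ)) := by
          calc m * log u ≤ m * (|log u| * log (1 / δ)) := by
                gcongr
                exact (le_abs_self _).trans (le_mul_of_one_le_right (abs_nonneg _) hL1)
            _ = _ := by ring
        linarith
      · simp only [hΦ, Set.indicator, Set.mem_ofPred_eq, h, if_false, norm_zero]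
        positivity
    · filter_upwards [ae_restrict_mem measurableSet_Ioi] with u (hu : 0 < u)
      have hq : Tendsto (fun δ : ℝ => 1 + (B + m * log u) / (m * log (1 / δ))) (𝓝[>] 0)
          (𝓝 (1 + 0)) :=
        ((hL.const_mul_atTop (by positivity)).const_div_atTop _).const_add 1
      have hF := (hq.pow k).const_mul (sin (π * u) ^ 2 / u ^ 2)
      rw [add_zero, one_pow, mul_one] at hF
      refine hF.congr' ?_
      have hlarge := (hL.const_mul_atTop (by positivity : (0 : ℝ) < m)).eventually_gt_atTop
        (-(B + m * log u))
      filter_upwards [hpos, hL.eventually_ge_atTop 1, hlarge] with δ hδ hL1 hδu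
      have hmL : 1 ≤ m * log (1 / δ) := one_le_mul_of_one_le_of_one_le hmR hL1
      have h : 1 < D * (u / (m * δ)) ^ m := by
        rw [← log_pos_iff (by positivity), log_mul_div_pow hm0 hD hδ hu]
        linarith
      simp only [hΦ, Set.indicator, Set.mem_ofPred_eq, h, if_true]
      rw [log_mul_div_pow hm0 hD hδ hu]
      congr 2
      field_simp
      ring
  rw [integral_sin_pi_mul_sq_div_sq_Ioi] at hlim
  have h1 := hlim.const_mul (2 / π ^ 2)
  rw [show 2 / π ^ 2 * (π ^ 2 / 2) = 1 by field_simp] at h1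
  refine h1.congr' ?_
  filter_upwards [hpos, hL.eventually_ge_atTop 1] with δ hδ hL1
  have hΦe : ∀ u, Φ δ u = (m * log (1 / δ))⁻¹ ^ k *
      {u : ℝ | 1 < D * (u / (m * δ)) ^ m}.indicator
        (fun u => sin (π * u) ^ 2 / u ^ 2 * log (D * (u / (m * δ)) ^ m) ^ k) u := by
    intro u
    simp only [hΦ, Set.indicator, mul_ite, mul_zero, div_eq_mul_inv, mul_pow]
    congr 1
    ring
  simp_rw [hΦe]
  rw [integral_const_mul, main_term_integral_eq m k hm0 hD hδ]
  have hL0 : log (1 / δ) ≠ 0 := (one_pos.trans_le hL1).ne'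
  generalize log (1 / δ) = L at *
  generalize (∫ u in Set.Ioi (0 : ℝ), (_ : ℝ)) = I
  rw [inv_pow, mul_pow]
  field_simp
  ring
end

section
/- Let m ≥ 2 and k ≥ 1 be integers, let n_1, …, n_k be positive integers and ε_1, …, ε_k ∈ {+1, −1} with Σ_{j=1}^k ε_j n_j^{1/m} = 0. Then there exist a partition of {1, …, k} into nonempty sets S_1, …, S_l, distinct m-th power-free positive integers q_1, …, q_l, and positive integers r_1, …, r_k, such that n_j = q_i · r_j^m for every i and every j ∈ S_i, and Σ_{j ∈ S_i} ε_j r_j = 0 for every i = 1, …, l. -/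
open Polynomial in
/-- The minimal polynomial over `ℚ` of an irrational positive radical `x` is `X ^ d - b`
with `2 ≤ d`, so its next-to-leading coefficient vanishes. -/
theorem minpoly_nextCoeff_eq_zero_of_pow_eq_rat {x : ℝ} {m : ℕ} {c : ℚ} (hm : m ≠ 0) (hx : 0 < x)
    (hxc : x ^ m = c) (hirr : Irrational x) : (minpoly ℚ x).nextCoeff = 0 := by
  have hroot : aeval x (X ^ m - C c : ℚ[X]) = 0 := by simp [hxc]
  have hint : IsIntegral ℚ x := ⟨X ^ m - C c, monic_X_pow_sub_C c hm, by simpa using hroot⟩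
  set p := minpoly ℚ x with hp
  have hmonic : p.Monic := minpoly.monic hint
  have hdvd : p ∣ X ^ m - C c := minpoly.dvd ℚ x hroot
  have hsplits : (p.map (algebraMap ℚ ℂ)).Splits := IsAlgClosed.splits _
  have hnorm : ∀ z ∈ (p.map (algebraMap ℚ ℂ)).roots, ‖z‖ = x := by
    intro z hz
    have hz0 : aeval z p = 0 := by
      have := (mem_roots'.1 hz).2
      rwa [IsRoot, eval_map_algebraMap] at this
    have hz1 : aeval z (X ^ m - C c : ℚ[X]) = 0 := by
      obtain ⟨g, hg⟩ := hdvd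
      rw [hg, map_mul, hz0, zero_mul]
    have hz2 : z ^ m = ((x ^ m : ℝ) : ℂ) := by
      rw [hxc]
      simpa [sub_eq_zero] using hz1
    have hz3 : ‖z‖ ^ m = x ^ m := by
      rw [← norm_pow, hz2, Complex.norm_real, Real.norm_of_nonneg (by positivity)]
    exact (pow_left_inj₀ (norm_nonneg z) hx.le hm).1 hz3
  have hcoeff : ((|p.coeff 0| : ℚ) : ℝ) = x ^ p.natDegree := by
    have h := hsplits.coeff_zero_eq_prod_roots_of_monic (hmonic.map _)
    have hcard : (p.map (algebraMap ℚ ℂ)).roots.card = p.natDegree := by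
      rw [← hsplits.natDegree_eq_card_roots, natDegree_map]
    have hprod : ‖(p.map (algebraMap ℚ ℂ)).roots.prod‖ = x ^ p.natDegree := by
      rw [← hcard, ← Multiset.prod_replicate, ← Multiset.map_const', ← Multiset.map_congr rfl hnorm]
      exact map_multiset_prod (normHom : ℂ →*₀ ℝ) _
    have h2 := congrArg norm h
    rw [norm_mul, hprod, norm_pow, norm_neg, norm_one, one_pow, one_mul, coeff_map] at h2
    rw [← h2]
    simp
  have hpos : p.natDegree ≠ 0 := (minpoly.natDegree_pos hint).ne'
  have hne1 : p.natDegree ≠ 1 := by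
    intro h1
    rw [h1, pow_one] at hcoeff
    exact hirr ⟨_, hcoeff⟩
  have hpeq : p = X ^ p.natDegree - C |p.coeff 0| := by
    refine (eq_of_monic_of_dvd_of_natDegree_le hmonic (monic_X_pow_sub_C _ hpos) ?_ ?_).symm
    · exact minpoly.dvd ℚ x (by simp [hcoeff])
    · rw [natDegree_X_pow_sub_C]
  rw [nextCoeff_of_natDegree_pos (Nat.pos_of_ne_zero hpos)]
  have h := congrArg (fun f => f.coeff (p.natDegree - 1)) hpeq
  simp only [coeff_sub, coeff_X_pow, coeff_C] at h
  rw [h, if_neg (by omega), if_neg (by omega), sub_zero]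

/-- Positive real radicals with pairwise irrational ratios are linearly independent over `ℚ`. -/
theorem eq_zero_of_sum_rat_mul_radical_eq_zero {ι : Type*} (s : Finset ι) (a : ι → ℝ) (c : ι → ℚ)
    {m : ℕ} (hm : m ≠ 0) (hpos : ∀ i ∈ s, 0 < a i) (hrat : ∀ i ∈ s, ∃ b : ℚ, a i ^ m = b)
    (hirr : ∀ i ∈ s, ∀ j ∈ s, i ≠ j → Irrational (a i / a j))
    (hsum : ∑ i ∈ s, (c i : ℝ) * a i = 0) : ∀ i ∈ s, c i = 0 := by
  classical
  intro j hj
  have hquot : ∀ i ∈ s, ∃ b : ℚ, (a i / a j) ^ m = b := by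
    intro i hi
    obtain ⟨b, hb⟩ := hrat i hi
    obtain ⟨d, hd⟩ := hrat j hj
    exact ⟨b / d, by rw [div_pow, hb, hd]; push_cast; rfl⟩
  let T : Set ℝ := (fun i => a i / a j) '' s
  let K := IntermediateField.adjoin ℚ T
  have hTfin : T.Finite := s.finite_toSet.image _
  have hTint : ∀ x ∈ T, IsIntegral ℚ x := by
    rintro x ⟨i, hi, rfl⟩
    obtain ⟨b, hb⟩ := hquot i hi
    refine IsIntegral.of_pow (Nat.pos_of_ne_zero hm) ?_
    rw [hb]
    exact isIntegral_algebraMap (R := ℚ) (x := b)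
  have : Finite T := hTfin
  have : FiniteDimensional ℚ K := IntermediateField.finiteDimensional_adjoin hTint
  have hmem : ∀ i ∈ s, a i / a j ∈ K := fun i hi =>
    IntermediateField.subset_adjoin ℚ T ⟨i, hi, rfl⟩
  let y : s → K := fun i => ⟨a i / a j, hmem i i.2⟩
  have hzero : ∑ i : s, c i • y i = 0 := by
    apply Subtype.ext
    have h : ∑ i ∈ s, (c i : ℝ) * (a i / a j) = 0 := by
      simp_rw [← mul_div_assoc]
      rw [← Finset.sum_div, hsum, zero_div]
    rw [← Finset.sum_coe_sort] at h
    simpa [y, Algebra.smul_def] using h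
  have htrace : ∀ i : s, (i : ι) ≠ j → Algebra.trace ℚ K (y i) = 0 := by
    intro i hij
    obtain ⟨b, hb⟩ := hquot i i.2
    have h := minpoly_nextCoeff_eq_zero_of_pow_eq_rat hm (div_pos (hpos i i.2) (hpos j hj)) hb
      (hirr i i.2 j hj hij)
    have hmin : minpoly ℚ (y i) = minpoly ℚ (a i / a j) :=
      (minpoly.algebraMap_eq (algebraMap K ℝ).injective (y i)).symm
    rw [trace_eq_finrank_mul_minpoly_nextCoeff, hmin, h, neg_zero, mul_zero]
  have hone : y ⟨j, hj⟩ = 1 := Subtype.ext (div_self (hpos j hj).ne')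
  have h := congrArg (Algebra.trace ℚ K) hzero
  rw [map_sum, map_zero, Finset.sum_eq_single ⟨j, hj⟩] at h
  · rw [map_smul, hone, ← map_one (algebraMap ℚ K), Algebra.trace_algebraMap] at h
    simpa [Module.finrank_pos.ne'] using h
  · intro i _ hi
    rw [map_smul, htrace i (fun h => hi (Subtype.ext h)), smul_zero]
  · simp

theorem Nat.exists_powerFree_mul_pow {m : ℕ} (hm : m ≠ 0) (n : ℕ) (hn : 0 < n) :
    ∃ q r : ℕ, (0 < q ∧ ∀ p : ℕ, p.Prime → ¬ p ^ m ∣ q) ∧ 0 < r ∧ n = q * r ^ m := by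
  induction n using Nat.strong_induction_on with
  | _ n ih =>
    by_cases h : ∀ p : ℕ, p.Prime → ¬ p ^ m ∣ n
    · exact ⟨n, 1, ⟨hn, h⟩, one_pos, by simp⟩
    · push Not at h
      obtain ⟨p, hp, n', rfl⟩ := h
      have hn' : 0 < n' := Nat.pos_of_mul_pos_left hn
      obtain ⟨q, r, hq, hr, rfl⟩ := ih n'
        (lt_mul_of_one_lt_left hn' (Nat.one_lt_pow hm hp.one_lt)) hn'
      exact ⟨q, p * r, hq, Nat.mul_pos hp.pos hr, by rw [mul_pow]; ring⟩

theorem Nat.powerFree_eq_of_mul_pow_eq {m q q' u v : ℕ}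
    (hq : 0 < q ∧ ∀ p : ℕ, p.Prime → ¬ p ^ m ∣ q) (hq' : 0 < q' ∧ ∀ p : ℕ, p.Prime → ¬ p ^ m ∣ q')
    (hu : u ≠ 0) (hv : v ≠ 0) (h : q * u ^ m = q' * v ^ m) : q = q' := by
  refine Nat.eq_of_factorization_eq hq.1.ne' hq'.1.ne' fun p => ?_
  by_cases hp : p.Prime
  · have h1 : q.factorization p < m := by
      by_contra! hle
      exact hq.2 p hp ((hp.pow_dvd_iff_le_factorization hq.1.ne').2 hle)
    have h2 : q'.factorization p < m := by
      by_contra! hle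
      exact hq'.2 p hp ((hp.pow_dvd_iff_le_factorization hq'.1.ne').2 hle)
    have h3 := congrArg (fun t => t.factorization p) h
    simp only [Nat.factorization_mul hq.1.ne' (pow_ne_zero m hu),
      Nat.factorization_mul hq'.1.ne' (pow_ne_zero m hv), Nat.factorization_pow,
      Finsupp.add_apply, Finsupp.smul_apply, smul_eq_mul] at h3
    have h4 := congrArg (· % m) h3
    simpa [Nat.add_mul_mod_self_left, Nat.mod_eq_of_lt h1, Nat.mod_eq_of_lt h2] using h4
  · simp [Nat.factorization_eq_zero_of_not_prime, hp]

/-- The ratio of the `m`-th roots of two distinct `m`-th power-free numbers is irrational. -/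
theorem irrational_rpow_div_rpow_of_powerFree {m q q' : ℕ} (hm : m ≠ 0)
    (hq : 0 < q ∧ ∀ p : ℕ, p.Prime → ¬ p ^ m ∣ q) (hq' : 0 < q' ∧ ∀ p : ℕ, p.Prime → ¬ p ^ m ∣ q')
    (hne : q ≠ q') :
    Irrational ((q : ℝ) ^ ((1 : ℝ) / m) / (q' : ℝ) ^ ((1 : ℝ) / m)) := by
  rintro ⟨t, ht⟩
  have hq0 : (0 : ℝ) < q := by exact_mod_cast hq.1
  have hq'0 : (0 : ℝ) < q' := by exact_mod_cast hq'.1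
  have htpos : 0 < t := by
    have : (0 : ℝ) < t := by rw [ht]; positivity
    exact_mod_cast this
  have hpow : (t : ℝ) ^ m = q / q' := by
    rw [ht, div_pow, one_div, Real.rpow_inv_natCast_pow hq0.le hm,
      Real.rpow_inv_natCast_pow hq'0.le hm]
  have hpow' : t ^ m = (q : ℚ) / q' := by
    refine Rat.cast_injective (α := ℝ) ?_
    push_cast
    exact hpow
  have hnum : (t.num.natAbs : ℚ) / t.den = t := by
    have h : ((t.num.natAbs : ℤ) : ℚ) = t.num := by
      rw [Int.natAbs_of_nonneg (Rat.num_pos.2 htpos).le]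
    rw [← Int.cast_natCast, h, Rat.num_div_den]
  have hden : (t.den : ℚ) ≠ 0 := by exact_mod_cast t.den_nz
  have hq'Q : (q' : ℚ) ≠ 0 := by exact_mod_cast hq'.1.ne'
  rw [← hnum, div_pow, div_eq_div_iff (pow_ne_zero _ hden) hq'Q] at hpow'
  refine hne (Nat.powerFree_eq_of_mul_pow_eq hq hq' (u := t.den) (v := t.num.natAbs) t.den_nz
    (Int.natAbs_ne_zero.2 (Rat.num_pos.2 htpos).ne') ?_)
  rw [mul_comm q']
  exact_mod_cast hpow'.symm


/-- If a signed sum of `m`-th roots of positive integers vanishes, the index set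
can be partitioned into blocks on which the `n_j` share a common `m`-th
power-free part `q_i`, with the corresponding signed sums of the `r_j`
vanishing blockwise. -/
theorem vanishing_signed_sum_partition
    (m k : ℕ) (hm : 2 ≤ m) (hk : 1 ≤ k)
    (n : Fin k → ℕ) (hn : ∀ j, 0 < n j)
    (ε : Fin k → ℤ) (hε : ∀ j, ε j = 1 ∨ ε j = -1)
    (hsum : ∑ j, (ε j : ℝ) * (n j : ℝ) ^ ((1 : ℝ) / m) = 0) :
    ∃ (l : ℕ) (S : Fin l → Finset (Fin k)) (q : Fin l → ℕ) (rr : Fin k → ℕ),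
      (∀ i, (S i).Nonempty) ∧
      (∀ j : Fin k, ∃! i, j ∈ S i) ∧
      Function.Injective q ∧
      (∀ i, 0 < q i ∧ ∀ p : ℕ, p.Prime → ¬ p ^ m ∣ q i) ∧
      (∀ j, 0 < rr j) ∧
      (∀ i, ∀ j ∈ S i, n j = q i * rr j ^ m) ∧
      (∀ i, ∑ j ∈ S i, ε j * (rr j : ℤ) = 0) := by
  classical
  have hm0 : m ≠ 0 := by omega
  choose Q r hQ hr hQr using fun j => Nat.exists_powerFree_mul_pow hm0 (n j) (hn j)
  let s : Finset ℕ := Finset.univ.image Q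
  have hfree : ∀ t ∈ s, 0 < t ∧ ∀ p : ℕ, p.Prime → ¬ p ^ m ∣ t := by
    intro t ht
    obtain ⟨j, -, rfl⟩ := Finset.mem_image.1 ht
    exact hQ j
  have hroot : ∀ j, (n j : ℝ) ^ ((1 : ℝ) / m) = r j * (Q j : ℝ) ^ ((1 : ℝ) / m) := by
    intro j
    conv_lhs => rw [hQr j]
    push_cast
    rw [Real.mul_rpow (by positivity) (by positivity), one_div,
      Real.pow_rpow_inv_natCast (by positivity) hm0, mul_comm]
  have hgroup : ∑ t ∈ s, ((∑ j with Q j = t, ε j * (r j : ℤ) : ℤ) : ℚ) *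
      (t : ℝ) ^ ((1 : ℝ) / m) = 0 := by
    rw [← hsum, ← Finset.sum_fiberwise_of_maps_to
      (fun j _ => Finset.mem_image_of_mem Q (Finset.mem_univ j))]
    refine Finset.sum_congr rfl fun t _ => ?_
    push_cast
    rw [Finset.sum_mul]
    refine Finset.sum_congr rfl fun j hj => ?_
    rw [hroot j, (Finset.mem_filter.1 hj).2, mul_assoc]
  have hzero := eq_zero_of_sum_rat_mul_radical_eq_zero s (fun t => (t : ℝ) ^ ((1 : ℝ) / m))
    (fun t => ((∑ j with Q j = t, ε j * (r j : ℤ) : ℤ) : ℚ)) hm0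
    (fun t ht => Real.rpow_pos_of_pos (by exact_mod_cast (hfree t ht).1) _)
    (fun t _ => ⟨t, by rw [one_div, Real.rpow_inv_natCast_pow t.cast_nonneg hm0]; simp⟩)
    (fun t ht t' ht' hne =>
      irrational_rpow_div_rpow_of_powerFree hm0 (hfree t ht) (hfree t' ht') hne)
    hgroup
  let e : Fin s.card ≃ s := s.equivFin.symm
  refine ⟨s.card, fun i => {j | Q j = e i}, fun i => e i, r, fun i => ?_, fun j => ?_, ?_,
    fun i => hfree _ (e i).2, hr, fun i j hj => ?_, fun i => ?_⟩
  · obtain ⟨j, -, hj⟩ := Finset.mem_image.1 (e i).2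
    exact ⟨j, by simpa using hj⟩
  · refine ⟨e.symm ⟨Q j, Finset.mem_image_of_mem Q (Finset.mem_univ j)⟩, by simp, fun i hi => ?_⟩
    rw [Equiv.eq_symm_apply]
    exact Subtype.ext (Finset.mem_filter.1 hi).2.symm
  · exact Subtype.val_injective.comp e.injective
  · have h : Q j = e i := (Finset.mem_filter.1 hj).2
    simpa only [h] using hQr j
  · exact_mod_cast hzero _ (e i).2
end
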